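/- arXiv:0901.4734 — 6 statements merged into one kernel-verified Lean document; each statement's English description precedes it below -/
import Mathlib

section
/- Let H ≤ F be a subgroup, Σ = { ω ∈ ∂F : Σ_{h∈H} (2m−1)^{−b_ω(h)} = ∞ }, and let Λ = { ω ∈ ∂F : sup_{h∈H} (h|ω) = ∞ } be the limit set of H. Then Σ ⊆ Λ: if the series Σ_{h∈H} (2m−1)^{−b_ω(h)} diverges at a point ω ∈ ∂F, then the Gromov products (h|ω), h ∈ H, are unbounded. -/
open MeasureTheory Filter Topology
open scoped ENNReal symmDiff

noncomputable section

/-- A letter of the alphabet `A ∪ A⁻¹` for the free group on `Fin m`. -/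
abbrev Letter (m : ℕ) := Fin m × Bool

/-- The inverse letter. -/
def linv {m : ℕ} (x : Letter m) : Letter m := (x.1, !x.2)

/-- A sequence of letters is reduced if no letter is followed by its inverse. -/
def IsRedSeq {m : ℕ} (ω : ℕ → Letter m) : Prop := ∀ n, ω (n + 1) ≠ linv (ω n)

/-- The boundary `∂F`: infinite reduced words. -/
abbrev Boundary (m : ℕ) := {ω : ℕ → Letter m // IsRedSeq ω}

/-- Word length of an element of the free group. -/
def wlen {m : ℕ} (g : FreeGroup (Fin m)) : ℕ := g.toWord.length

/-- The truncation `[ω]ₙ`: the group element given by the first `n` letters of `ω`. -/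
def trunc {m : ℕ} (ω : Boundary m) (n : ℕ) : FreeGroup (Fin m) :=
  FreeGroup.mk (List.ofFn fun i : Fin n => ω.1 i)

/-- Cylinder set `C_g`. -/
def cylinder {m : ℕ} (g : FreeGroup (Fin m)) : Set (Boundary m) :=
  {ω | trunc ω (wlen g) = g}

/-- The Gromov product `(g|ω)`: length of the longest common initial segment of the
reduced word of `g` and `ω`. -/
def gromov {m : ℕ} (g : FreeGroup (Fin m)) (ω : Boundary m) : ℕ :=
  sSup {k | ∀ i < k, g.toWord[i]? = some (ω.1 i)}

/-- The Busemann function `b_ω(g) = |g| - 2 (g|ω)`. -/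
def busemann {m : ℕ} (g : FreeGroup (Fin m)) (ω : Boundary m) : ℤ :=
  (wlen g : ℤ) - 2 * (gromov g ω : ℤ)

/-- The number of letters cancelled in the free reduction of the concatenation
of a finite word `w` with an infinite reduced word `ω`. -/
def cancelLen {m : ℕ} (w : List (Letter m)) (ω : ℕ → Letter m) : ℕ :=
  sSup {k | k ≤ w.length ∧ ∀ i < k, w[w.length - 1 - i]? = some (linv (ω i))}

/-- The sequence of letters of the free reduction of (reduced word of `g`) ++ `ω`. -/
def actSeq {m : ℕ} (g : FreeGroup (Fin m)) (ω : Boundary m) (n : ℕ) : Letter m :=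
  if h : n < g.toWord.length - cancelLen g.toWord ω.1
  then g.toWord[n]'(by omega)
  else ω.1 (n - (g.toWord.length - cancelLen g.toWord ω.1) + cancelLen g.toWord ω.1)

theorem linv_linv {m : ℕ} (x : Letter m) : linv (linv x) = x := by
  simp [linv]

theorem toWord_chain {m : ℕ} (g : FreeGroup (Fin m)) {j : ℕ} (hj : j + 1 < g.toWord.length) :
    g.toWord[j + 1]'hj ≠ linv (g.toWord[j]'(by omega)) := by
  intro h
  have hsplit : g.toWord = g.toWord.take j ++
      (g.toWord[j]'(by omega)) :: (g.toWord[j+1]'hj) :: g.toWord.drop (j + 2) := by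
    conv_lhs => rw [← List.take_append_drop j g.toWord]
    congr 1
    rw [List.drop_eq_getElem_cons (by omega)]
    congr 1
    rw [List.drop_eq_getElem_cons (by omega)]
  rw [h] at hsplit
  have hred : FreeGroup.reduce g.toWord = g.toWord := FreeGroup.reduce_toWord g
  exact FreeGroup.reduce.not (by rw [hred, hsplit]; rfl)

theorem cancelLen_spec {m : ℕ} (w : List (Letter m)) (ω : ℕ → Letter m) :
    cancelLen w ω ≤ w.length ∧
      ∀ i < cancelLen w ω, w[w.length - 1 - i]? = some (linv (ω i)) := by
  have : cancelLen w ω ∈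
      {k | k ≤ w.length ∧ ∀ i < k, w[w.length - 1 - i]? = some (linv (ω i))} := by
    apply Nat.sSup_mem ⟨0, by simp⟩ ⟨w.length, fun x hx => hx.1⟩
  exact this

theorem cancelLen_max {m : ℕ} (w : List (Letter m)) (ω : ℕ → Letter m)
    (hlt : cancelLen w ω < w.length) :
    w[w.length - 1 - cancelLen w ω]? ≠ some (linv (ω (cancelLen w ω))) := by
  intro hcon
  have hmem : cancelLen w ω + 1 ∈
      {k | k ≤ w.length ∧ ∀ i < k, w[w.length - 1 - i]? = some (linv (ω i))} := by
    refine ⟨hlt, fun i hi => ?_⟩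
    rcases Nat.lt_succ_iff_lt_or_eq.mp hi with h | h
    · exact (cancelLen_spec w ω).2 i h
    · subst h; exact hcon
  have := le_csSup ⟨w.length, fun x hx => hx.1⟩ hmem
  simp only [cancelLen] at this ⊢
  omega

theorem isRedSeq_actSeq {m : ℕ} (g : FreeGroup (Fin m)) (ω : Boundary m) :
    IsRedSeq (actSeq g ω) := by
  intro n
  obtain ⟨hkle, hcan⟩ := cancelLen_spec g.toWord ω.1
  by_cases h1 : n + 1 < g.toWord.length - cancelLen g.toWord ω.1
  · have h0 : n < g.toWord.length - cancelLen g.toWord ω.1 := by omega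
    rw [show actSeq g ω (n + 1) = g.toWord[n + 1]'(by omega) from dif_pos h1,
        show actSeq g ω n = g.toWord[n]'(by omega) from dif_pos h0]
    exact toWord_chain g (by omega)
  · by_cases h0 : n < g.toWord.length - cancelLen g.toWord ω.1
    · have hklt : cancelLen g.toWord ω.1 < g.toWord.length := by omega
      have hidx : n = g.toWord.length - 1 - cancelLen g.toWord ω.1 := by omega
      have e0 : actSeq g ω n = g.toWord[n]'(by omega) := dif_pos h0
      have e1 : actSeq g ω (n + 1) =
          ω.1 (n + 1 - (g.toWord.length - cancelLen g.toWord ω.1) +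
            cancelLen g.toWord ω.1) := dif_neg h1
      have harg : n + 1 - (g.toWord.length - cancelLen g.toWord ω.1) +
          cancelLen g.toWord ω.1 = cancelLen g.toWord ω.1 := by omega
      rw [harg] at e1
      rw [e0, e1]
      intro hcon
      apply cancelLen_max g.toWord ω.1 hklt
      subst hidx
      rw [List.getElem?_eq_getElem (by omega), hcon, linv_linv]
    · have e0 : actSeq g ω n =
          ω.1 (n - (g.toWord.length - cancelLen g.toWord ω.1) +
            cancelLen g.toWord ω.1) := dif_neg h0
      have e1 : actSeq g ω (n + 1) =
          ω.1 (n + 1 - (g.toWord.length - cancelLen g.toWord ω.1) +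
            cancelLen g.toWord ω.1) := dif_neg (by omega)
      have harg : n + 1 - (g.toWord.length - cancelLen g.toWord ω.1) +
          cancelLen g.toWord ω.1 =
          (n - (g.toWord.length - cancelLen g.toWord ω.1) + cancelLen g.toWord ω.1) + 1 := by
        omega
      rw [e0, e1, harg]
      exact ω.2 _

/-- The boundary action of `F` on `∂F`: `g · ω` is the free reduction of the
concatenation of the reduced word of `g` with `ω`. -/
def bact {m : ℕ} (g : FreeGroup (Fin m)) (ω : Boundary m) : Boundary m :=
  ⟨actSeq g ω, isRedSeq_actSeq g ω⟩


section FreeReduction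

open FreeGroup

variable {α : Type*}

/-- Concatenating two reduced words cancels a suffix of the first word against a prefix of
the second, and leaves a reduced word. -/
theorem exists_cancellation {L₁ L₂ : List (α × Bool)} (h₁ : IsReduced L₁) (h₂ : IsReduced L₂) :
    ∃ a b c, L₁ = a ++ c ∧ L₂ = invRev c ++ b ∧ IsReduced (a ++ b) := by
  induction L₁ using List.reverseRecOn generalizing L₂ with
  | nil => exact ⟨[], L₂, [], by simp, by simp, by simpa using h₂⟩
  | append_singleton L x ih =>
    by_cases hx : L₂.head? = some (x.1, !x.2)
    · obtain ⟨t, rfl⟩ : ∃ t, L₂ = (x.1, !x.2) :: t := by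
        cases L₂ with
        | nil => simp at hx
        | cons y t => exact ⟨t, by simpa using hx⟩
      obtain ⟨a, b, c, rfl, rfl, hab⟩ := ih (L₂ := t)
        (h₁.infix ⟨[], [x], by simp⟩) (h₂.infix ⟨[(x.1, !x.2)], [], by simp⟩)
      exact ⟨a, b, c ++ [x], by simp, by simp [invRev], hab⟩
    · refine ⟨L ++ [x], L₂, [], by simp, by simp, ?_⟩
      refine List.isChain_append.2 ⟨h₁, h₂, ?_⟩
      intro y hy z hz hyz
      obtain rfl : x = y := by simpa using hy
      by_contra hne
      apply hx
      rw [Option.mem_def.1 hz, Option.some_inj]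
      ext
      · exact hyz.symm
      · simp only
        revert hne
        cases x.2 <;> cases z.2 <;> simp

variable [DecidableEq α]

theorem exists_toWord_mul (x y : FreeGroup α) :
    ∃ a b c, x.toWord = a ++ c ∧ y.toWord = invRev c ++ b ∧ (x * y).toWord = a ++ b := by
  obtain ⟨a, b, c, hx, hy, hab⟩ :=
    exists_cancellation (isReduced_toWord (x := x)) (isReduced_toWord (x := y))
  refine ⟨a, b, c, hx, hy, ?_⟩
  have hmul : x * y = mk (a ++ b) := by
    rw [← mk_toWord (x := x), ← mk_toWord (x := y), hx, hy]
    simp only [← mul_mk, ← inv_mk]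
    group
  rw [hmul, toWord_mk, hab.reduce_eq]

variable {H : Subgroup (FreeGroup α)} {g : FreeGroup α}

/-- If no element of `H` starts with `g`, then right multiplication by `g` never cancels
`g` completely against an element of `H`. -/
theorem exists_suffix_toWord_mul (hg : ∀ h ∈ H, ¬ g.toWord <+: h.toWord)
    {h : FreeGroup α} (hh : h ∈ H) :
    ∃ a b c, b ≠ [] ∧ g.toWord = c ++ b ∧ (h * g).toWord = a ++ b := by
  obtain ⟨a, b, c, hx, hy, hab⟩ := exists_toWord_mul h g
  refine ⟨a, b, invRev c, ?_, hy, hab⟩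
  rintro rfl
  refine hg h⁻¹ (H.inv_mem hh) ⟨invRev a, ?_⟩
  rw [hy, toWord_inv, hx, invRev_append, List.append_nil]

/-- If no element of `H` starts with `g`, then nested translates of `g` under `H` have
comparable lengths. -/
theorem length_toWord_mul_lt (hg : ∀ h ∈ H, ¬ g.toWord <+: h.toWord)
    {h k : FreeGroup α} (hh : h ∈ H) (hk : k ∈ H)
    (hpre : (h * g).toWord <+: (k * g).toWord) :
    (k * g).toWord.length < (h * g).toWord.length + g.toWord.length := by
  obtain ⟨v, hv⟩ := hpre
  obtain ⟨a, b, c, hb, hgw, hhg⟩ := exists_suffix_toWord_mul hg hh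
  have hred : IsReduced (g.toWord ++ v) := by
    have h₁ : IsReduced (c ++ b) := hgw ▸ isReduced_toWord
    have h₂ : IsReduced (a ++ b ++ v) := by
      rw [← hhg, hv]
      exact isReduced_toWord
    rw [hgw]
    exact h₁.append_overlap (h₂.infix ⟨a, [], by simp⟩) hb
  have hword : (g * mk v).toWord = g.toWord ++ v := by
    conv_lhs => rw [← mk_toWord (x := g), mul_mk, toWord_mk, hred.reduce_eq]
  have hkg : k * g = h * g * mk v := by
    rw [← mk_toWord (x := k * g), ← hv, ← mul_mk, mk_toWord]
  have hmem : g * mk v * g⁻¹ ∈ H := by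
    have : g * mk v * g⁻¹ = h⁻¹ * k := by
      rw [eq_inv_mul_iff_mul_eq, ← mul_assoc, ← mul_assoc, ← hkg, mul_inv_cancel_right]
    rw [this]
    exact H.mul_mem (H.inv_mem hh) hk
  obtain ⟨a', b', c', hx, hy, hab⟩ := exists_toWord_mul (g * mk v) g⁻¹
  have hc : c'.length ≤ g.toWord.length := by
    have := congrArg List.length hy
    simp only [toWord_inv, invRev_length, List.length_append] at this
    omega
  by_contra! hlen
  rw [← hv, List.length_append] at hlen
  rw [hword] at hx
  have hlen' := congrArg List.length hx
  simp only [List.length_append] at hlen'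
  refine hg _ hmem ?_
  rw [hab]
  refine List.IsPrefix.trans ?_ (List.prefix_append a' b')
  exact List.prefix_of_prefix_length_le ⟨v, hx⟩ (List.prefix_append a' c') (by omega)

/-- If no element of `H` starts with `g`, then at most `|g|` of the translates of `g` under
`H` are prefixes of a given word. -/
theorem card_filter_prefix_le (hg : ∀ h ∈ H, ¬ g.toWord <+: h.toWord)
    (S : Finset H) (w : List (α × Bool)) :
    (S.filter fun h : H => ((h : FreeGroup α) * g).toWord <+: w).card ≤ g.toWord.length := by
  set T := S.filter fun h : H => ((h : FreeGroup α) * g).toWord <+: w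
  rcases T.eq_empty_or_nonempty with h0 | hne
  · simp only [h0, Finset.card_empty, Nat.zero_le]
  obtain ⟨h₀, hh₀, hmin⟩ :=
    T.exists_min_image (fun h : H => ((h : FreeGroup α) * g).toWord.length) hne
  have hpre : ∀ h ∈ T, ((h : FreeGroup α) * g).toWord <+: w := fun h hh =>
    (Finset.mem_filter.1 hh).2
  have hcard := Finset.card_le_card_of_injOn (s := T)
    (t := Finset.Ico (((h₀ : FreeGroup α) * g).toWord.length)
      (((h₀ : FreeGroup α) * g).toWord.length + g.toWord.length))
    (fun h : H => ((h : FreeGroup α) * g).toWord.length) ?_ ?_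
  · simpa using hcard
  · intro h hh
    simp only [Finset.coe_Ico, Set.mem_Ico]
    exact ⟨hmin h hh, length_toWord_mul_lt hg h₀.2 h.2
      (List.prefix_of_prefix_length_le (hpre _ hh₀) (hpre _ hh) (hmin h hh))⟩
  · intro h hh k hk hhk
    have := List.prefix_of_prefix_length_le (hpre _ hh) (hpre _ hk) (le_of_eq hhk)
    have := toWord_injective (this.eq_of_length hhk)
    exact Subtype.ext (mul_right_cancel this)

end FreeReduction

section Kraft

open FreeGroup

variable {m : ℕ}

/-- There are `(2m-1)^k` reduced continuations of length `k` of a given letter. -/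
theorem exists_finset_continuations (k : ℕ) (x : Letter m) :
    ∃ E : Finset (List (Letter m)), E.card = (2 * m - 1) ^ k ∧
      ∀ v, v ∈ E ↔ v.length = k ∧ IsReduced (x :: v) := by
  induction k generalizing x with
  | zero =>
    refine ⟨{[]}, by simp, fun v => ?_⟩
    simp only [Finset.mem_singleton, List.length_eq_zero_iff]
    exact ⟨fun h => ⟨h, h ▸ IsReduced.singleton⟩, fun h => h.1⟩
  | succ k ih =>
    choose E hcard hE using ih
    refine ⟨((Finset.univ.erase (linv x)).sigma E).map
      ⟨fun p => p.1 :: p.2, fun p q h => ?_⟩, ?_, fun v => ?_⟩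
    · obtain ⟨p₁, p₂⟩ := p
      obtain ⟨q₁, q₂⟩ := q
      simp only [List.cons.injEq] at h
      obtain ⟨rfl, rfl⟩ := h
      rfl
    · simp [Finset.card_sigma, hcard, Finset.card_erase_of_mem, pow_succ', mul_comm m 2]
    · have key : ∀ y : Letter m, y ≠ linv x ↔ (x.1 = y.1 → x.2 = y.2) := by
        rintro ⟨y₁, y₂⟩
        obtain ⟨x₁, x₂⟩ := x
        simp only [linv, ne_eq, Prod.mk.injEq, not_and]
        cases x₂ <;> cases y₂ <;> simp [eq_comm]
      cases v with
      | nil => simp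
      | cons y t =>
        simp only [Finset.mem_map, Finset.mem_sigma, Finset.mem_erase, Finset.mem_univ,
          and_true, hE, List.length_cons, isReduced_cons_cons, ← key]
        constructor
        · rintro ⟨⟨a, b⟩, ⟨h₁, h₂, h₃⟩, h⟩
          obtain ⟨rfl, rfl⟩ := List.cons.inj h
          exact ⟨congrArg (· + 1) h₂, h₁, h₃⟩
        · rintro ⟨h₁, h₂, h₃⟩
          exact ⟨⟨y, t⟩, ⟨h₂, Nat.succ.inj h₁, h₃⟩, rfl⟩

/-- Kraft's inequality with multiplicity for reduced words. -/
theorem sum_pow_sub_length_le {ι : Type*} (S : Finset ι) (f : ι → List (Letter m)) (L N : ℕ)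
    (hred : ∀ i ∈ S, IsReduced (f i)) (hne : ∀ i ∈ S, f i ≠ [])
    (hlen : ∀ i ∈ S, (f i).length ≤ L + 1)
    (hmult : ∀ w, (S.filter fun i => f i <+: w).card ≤ N) :
    ∑ i ∈ S, (2 * m - 1) ^ (L + 1 - (f i).length) ≤ N * (2 * m * (2 * m - 1) ^ L) := by
  choose E hcard hE using fun k x => exists_finset_continuations (m := m) k x
  set W : Finset (List (Letter m)) :=
    (Finset.univ.sigma (E L)).image fun p => p.1 :: p.2
  have hWcard : W.card ≤ 2 * m * (2 * m - 1) ^ L := by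
    refine Finset.card_image_le.trans ?_
    simp [Finset.card_sigma, hcard, mul_comm m 2]
  have hWmem : ∀ w, w.length = L + 1 → IsReduced w → w ∈ W := by
    intro w hw hr
    cases w with
    | nil => simp at hw
    | cons y t =>
      refine Finset.mem_image.2 ⟨⟨y, t⟩, ?_, rfl⟩
      simpa [hE] using And.intro (by simpa using hw) hr
  have hext : ∀ i ∈ S, (2 * m - 1) ^ (L + 1 - (f i).length) ≤
      (W.filter fun w => f i <+: w).card := by
    intro i hi
    rw [← hcard _ ((f i).getLast (hne i hi))]
    refine Finset.card_le_card_of_injOn (fun v => f i ++ v) ?_ ?_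
    · intro v hv
      obtain ⟨hv₁, hv₂⟩ := (hE _ _ _).1 hv
      have hr : IsReduced (f i ++ v) := by
        have := IsReduced.append_overlap (L₁ := (f i).dropLast)
          (L₂ := [(f i).getLast (hne i hi)]) (L₃ := v)
          (by rw [List.dropLast_append_getLast]; exact hred i hi) hv₂ (by simp)
        rwa [List.dropLast_append_getLast] at this
      have := hlen i hi
      exact Finset.mem_coe.2 (Finset.mem_filter.2
        ⟨hWmem _ (by rw [List.length_append]; omega) hr, List.prefix_append _ _⟩)
    · intro v _ v' _ h
      exact List.append_cancel_left h
  calc ∑ i ∈ S, (2 * m - 1) ^ (L + 1 - (f i).length)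
      ≤ ∑ i ∈ S, (W.filter fun w => f i <+: w).card := Finset.sum_le_sum hext
    _ = ∑ w ∈ W, (S.filter fun i => f i <+: w).card :=
        Finset.sum_card_bipartiteAbove_eq_sum_card_bipartiteBelow _
    _ ≤ W.card * N := by
        rw [← smul_eq_mul]
        exact Finset.sum_le_card_nsmul _ _ _ fun w _ => hmult w
    _ ≤ N * (2 * m * (2 * m - 1) ^ L) := by
        rw [mul_comm]
        exact Nat.mul_le_mul_left _ hWcard

end Kraft

section Gromov

open FreeGroup

variable {m : ℕ}

theorem le_gromov {g : FreeGroup (Fin m)} {ω : Boundary m} {k : ℕ}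
    (hk : ∀ i < k, g.toWord[i]? = some (ω.1 i)) : k ≤ gromov g ω := by
  refine le_csSup ⟨g.toWord.length, fun j hj => ?_⟩ hk
  by_contra! hlt
  simpa using hj _ hlt

theorem toWord_trunc (ω : Boundary m) (n : ℕ) :
    (trunc ω n).toWord = List.ofFn fun i : Fin n => ω.1 i := by
  rw [trunc, toWord_mk]
  refine IsReduced.reduce_eq (List.isChain_iff_getElem.2 fun i hi => ?_)
  simp only [List.getElem_ofFn]
  intro h
  by_contra hne
  refine ω.2 i (Prod.ext h.symm ?_)
  revert hne
  simp only [linv]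
  cases (ω.1 i).2 <;> cases (ω.1 (i + 1)).2 <;> simp

theorem le_gromov_of_trunc_prefix {g : FreeGroup (Fin m)} {ω : Boundary m} {n : ℕ}
    (h : (trunc ω n).toWord <+: g.toWord) : n ≤ gromov g ω := by
  refine le_gromov fun i hi => ?_
  obtain ⟨t, ht⟩ := h
  rw [← ht, toWord_trunc, List.getElem?_append_left (by simpa using hi)]
  simp [hi]

end Gromov

/-- If no element of `H` starts with `g`, then the Poincaré series of the coset `H g` converges
at the critical exponent of the free group. -/
theorem tsum_zpow_neg_wlen_mul_le {m : ℕ} (hm : 2 ≤ m) {H : Subgroup (FreeGroup (Fin m))}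
    {g : FreeGroup (Fin m)} (hg : ∀ h ∈ H, ¬ g.toWord <+: h.toWord) :
    ∑' h : H, ((2 * m - 1 : ℕ) : ℝ≥0∞) ^ (-(wlen ((h : FreeGroup (Fin m)) * g) : ℤ)) ≤
      (wlen g * (2 * m) : ℕ) := by
  set q : ℝ≥0∞ := ((2 * m - 1 : ℕ) : ℝ≥0∞) with hq
  have hq0 : q ≠ 0 := by simp only [hq, ne_eq, Nat.cast_eq_zero]; omega
  have hqt : q ≠ ⊤ := ENNReal.natCast_ne_top _
  have hq1 : 1 ≤ q := by simp only [hq, Nat.one_le_cast]; omega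
  refine ENNReal.summable.tsum_le_of_sum_le fun S => ?_
  set L := S.sup fun h => wlen ((h : FreeGroup (Fin m)) * g)
  have hlen : ∀ h ∈ S, wlen ((h : FreeGroup (Fin m)) * g) ≤ L + 1 := fun h hh =>
    (Finset.le_sup (f := fun h : H => wlen ((h : FreeGroup (Fin m)) * g)) hh).trans
      (Nat.le_succ L)
  have hkraft := sum_pow_sub_length_le S
    (fun h => ((h : FreeGroup (Fin m)) * g).toWord) L (wlen g)
    (fun _ _ => FreeGroup.isReduced_toWord)
    (fun h _ => by
      obtain ⟨a, b, c, hb, -, hab⟩ := exists_suffix_toWord_mul hg h.2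
      simp [hab, hb])
    hlen (card_filter_prefix_le hg S)
  have hterm : ∀ h ∈ S, q ^ (-(wlen ((h : FreeGroup (Fin m)) * g) : ℤ)) =
      q ^ (-(L + 1 : ℕ) : ℤ) *
        (((2 * m - 1) ^ (L + 1 - wlen ((h : FreeGroup (Fin m)) * g)) : ℕ) : ℝ≥0∞) := by
    intro h hh
    rw [Nat.cast_pow, ← hq, ← zpow_natCast, ← ENNReal.zpow_add hq0 hqt,
      Nat.cast_sub (hlen h hh)]
    congr 1
    ring
  rw [Finset.sum_congr rfl hterm, ← Finset.mul_sum, ← Nat.cast_sum]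
  calc q ^ (-(L + 1 : ℕ) : ℤ) * ((∑ h ∈ S,
        (2 * m - 1) ^ (L + 1 - wlen ((h : FreeGroup (Fin m)) * g)) : ℕ) : ℝ≥0∞)
      ≤ q ^ (-(L + 1 : ℕ) : ℤ) * ((wlen g * (2 * m * (2 * m - 1) ^ L) : ℕ) : ℝ≥0∞) := by
        gcongr
        exact hkraft
    _ = (wlen g * (2 * m) : ℕ) * (q ^ (-(L + 1 : ℕ) : ℤ) * q ^ (L : ℤ)) := by
        rw [zpow_natCast, hq]
        push_cast
        ring
    _ ≤ (wlen g * (2 * m) : ℕ) * 1 := by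
        gcongr
        rw [← ENNReal.zpow_add hq0 hqt]
        calc q ^ (-(L + 1 : ℕ) + (L : ℤ)) ≤ q ^ (0 : ℤ) :=
              ENNReal.zpow_le_of_le hq1 (by push_cast; omega)
          _ = 1 := zpow_zero q
    _ = _ := mul_one _

theorem wlen_mul_le {m : ℕ} (g h : FreeGroup (Fin m)) : wlen (g * h) ≤ wlen g + wlen h :=
  FreeGroup.norm_mul_le g h

/-- **`Σ` is contained in the limit set.** If the series `Σ_{h∈H} (2m-1)^{-b_ω(h)}`
diverges at `ω`, then the Gromov products `(h|ω)`, `h ∈ H`, are unbounded. -/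
theorem sigma_subset_limit_set (m : ℕ) (hm : 2 ≤ m)
    (H : Subgroup (FreeGroup (Fin m)))
    (SigH Λ : Set (Boundary m))
    (hSig : SigH = {ω : Boundary m |
      ∑' h : H, ((2 * m - 1 : ℕ) : ℝ≥0∞) ^ (-(busemann (h : FreeGroup (Fin m)) ω)) = ⊤})
    (hΛ : Λ = {ω : Boundary m | ∀ C : ℕ, ∃ g ∈ H, C < gromov g ω}) :
    SigH ⊆ Λ := by
  subst hSig hΛ
  intro ω hω
  by_contra hbdd
  simp only [Set.mem_ofPred_eq, not_forall, not_exists, not_and, not_lt] at hω hbdd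
  obtain ⟨C, hC⟩ := hbdd
  set g := trunc ω (C + 1)
  have hg : ∀ h ∈ H, ¬ g.toWord <+: h.toWord := fun h hh hpre =>
    absurd (le_gromov_of_trunc_prefix hpre) (by have := hC h hh; omega)
  set q : ℝ≥0∞ := ((2 * m - 1 : ℕ) : ℝ≥0∞) with hq
  have hq0 : q ≠ 0 := by simp only [hq, ne_eq, Nat.cast_eq_zero]; omega
  have hqt : q ≠ ⊤ := ENNReal.natCast_ne_top _
  have hq1 : 1 ≤ q := by simp only [hq, Nat.one_le_cast]; omega
  have hle : ∀ h : H, q ^ (-(busemann (h : FreeGroup (Fin m)) ω)) ≤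
      q ^ (2 * C + wlen g) * q ^ (-(wlen ((h : FreeGroup (Fin m)) * g) : ℤ)) := by
    intro h
    rw [← zpow_natCast, ← ENNReal.zpow_add hq0 hqt]
    refine ENNReal.zpow_le_of_le hq1 ?_
    have h₁ := hC h h.2
    have h₂ := wlen_mul_le (h : FreeGroup (Fin m)) g
    rw [busemann]
    push_cast
    omega
  refine absurd hω (ne_of_lt ((ENNReal.tsum_le_tsum hle).trans_lt ?_))
  rw [ENNReal.tsum_mul_left]
  exact ENNReal.mul_lt_top (ENNReal.pow_lt_top hqt.lt_top)
    ((tsum_zpow_neg_wlen_mul_le hm hg).trans_lt (ENNReal.natCast_lt_top _))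
end
end

section
/- Let H ≤ F be a subgroup and let ω ∈ ∂F be a boundary point whose ray projects to a geodesic ray in the Schreier graph of H, i.e. for every n ∈ ℕ and every h ∈ H one has |h·[ω]ₙ| ≥ n (so the minimal word length in the coset H[ω]ₙ equals n). Then b_ω(h) ≥ 0, equivalently |h| ≥ 2(h|ω), for every h ∈ H. -/
open MeasureTheory Filter Topology
open scoped ENNReal symmDiff

noncomputable section

theorem gromov_spec {m : ℕ} (g : FreeGroup (Fin m)) (ω : Boundary m) :
    ∀ i < gromov g ω, g.toWord[i]? = some (ω.1 i) := by
  refine Nat.sSup_mem (s := {k | ∀ i < k, g.toWord[i]? = some (ω.1 i)}) ⟨0, by simp⟩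
    ⟨wlen g, fun k hk => ?_⟩
  by_contra! hlt
  simpa [wlen] using hk _ hlt

theorem gromov_le_wlen {m : ℕ} (g : FreeGroup (Fin m)) (ω : Boundary m) :
    gromov g ω ≤ wlen g := by
  by_contra! hlt
  simpa [wlen] using gromov_spec g ω _ hlt

theorem trunc_gromov {m : ℕ} (g : FreeGroup (Fin m)) (ω : Boundary m) :
    trunc ω (gromov g ω) = FreeGroup.mk (g.toWord.take (gromov g ω)) := by
  refine congrArg FreeGroup.mk (List.ext_getElem? fun i => ?_)
  by_cases hi : i < gromov g ω
  · simp [hi, gromov_spec g ω i hi]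
  · simp [hi]

theorem wlen_inv_mul_trunc_gromov_le {m : ℕ} (g : FreeGroup (Fin m)) (ω : Boundary m) :
    wlen (g⁻¹ * trunc ω (gromov g ω)) ≤ wlen g - gromov g ω := by
  have hg : trunc ω (gromov g ω) * FreeGroup.mk (g.toWord.drop (gromov g ω)) = g := by
    rw [trunc_gromov, FreeGroup.mul_mk, List.take_append_drop, FreeGroup.mk_toWord]
  have hinv : g⁻¹ * trunc ω (gromov g ω) =
      (FreeGroup.mk (g.toWord.drop (gromov g ω)))⁻¹ := by
    rw [inv_mul_eq_iff_eq_mul, eq_mul_inv_iff_mul_eq, hg]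
  rw [hinv]
  calc FreeGroup.norm (FreeGroup.mk (g.toWord.drop (gromov g ω)))⁻¹
      ≤ (g.toWord.drop (gromov g ω)).length := by
        rw [FreeGroup.norm_inv_eq]; exact FreeGroup.norm_mk_le
    _ = wlen g - gromov g ω := List.length_drop

/-- **Geodesic rays in the Schreier graph have nonnegative Busemann function on `H`.**
If the ray of `ω` projects to a geodesic ray in the Schreier graph of `H`, i.e.
`|h·[ω]ₙ| ≥ n` for all `n` and `h ∈ H`, then `b_ω(h) ≥ 0`, equivalently
`|h| ≥ 2(h|ω)`, for every `h ∈ H`. -/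
theorem busemann_nonneg_of_geodesic_ray (m : ℕ) (hm : 2 ≤ m)
    (H : Subgroup (FreeGroup (Fin m))) (ω : Boundary m)
    (hgeo : ∀ n : ℕ, ∀ h ∈ H, (n : ℕ) ≤ wlen (h * trunc ω n)) :
    ∀ h ∈ H, 0 ≤ busemann h ω ∧ 2 * gromov h ω ≤ wlen h := by
  intro h hh
  have hlower := hgeo (gromov h ω) h⁻¹ (H.inv_mem hh)
  have hupper := wlen_inv_mul_trunc_gromov_le h ω
  have hle := gromov_le_wlen h ω
  unfold busemann
  omega
end
end

section
/- If H ≤ F is a subgroup of finite index, then the action of H on (∂F, μ) is ergodic: every measurable set E ⊆ ∂F with μ(E Δ h·E) = 0 for all h ∈ H satisfies μ(E) = 0 or μ(E) = 1. -/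
open MeasureTheory Filter Topology
open scoped ENNReal symmDiff

noncomputable section

open FreeGroup (IsReduced)

/-- The set of infinite reduced words beginning with the finite word `w`. -/
def wordCylinder {m : ℕ} (w : List (Letter m)) : Set (Boundary m) :=
  {ω | ∀ i (h : i < w.length), ω.1 i = w[i]}

/-- The initial segment of length `n` of an infinite reduced word. -/
def initialWord {m : ℕ} (ω : Boundary m) (n : ℕ) : List (Letter m) :=
  List.ofFn fun i : Fin n => ω.1 i

/-- Deletion of the first `k` letters of an infinite reduced word. -/
def boundaryShift {m : ℕ} (k : ℕ) (ω : Boundary m) : Boundary m :=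
  ⟨fun n => ω.1 (n + k), fun n => by
    have := ω.2 (n + k)
    rwa [show n + k + 1 = n + 1 + k by omega] at this⟩

theorem ne_linv_iff {m : ℕ} {a b : Letter m} : b ≠ linv a ↔ (a.1 = b.1 → a.2 = b.2) := by
  obtain ⟨a, s⟩ := a
  obtain ⟨b, t⟩ := b
  cases s <;> cases t <;> simp [linv, eq_comm]

theorem linv_ne_symm {m : ℕ} {a b : Letter m} (h : b ≠ linv a) : a ≠ linv b := by
  rintro rfl
  exact h (linv_linv b).symm

theorem isReduced_append_iff {m : ℕ} {u v : List (Letter m)} :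
    IsReduced (u ++ v) ↔
      IsReduced u ∧ IsReduced v ∧ ∀ a ∈ u.getLast?, ∀ b ∈ v.head?, b ≠ linv a := by
  simp only [FreeGroup.IsReduced, List.isChain_append, ne_linv_iff]

theorem isReduced_initialWord {m : ℕ} (ω : Boundary m) (n : ℕ) :
    IsReduced (initialWord ω n) := by
  rw [FreeGroup.IsReduced, List.isChain_iff_getElem]
  intro i hi
  simp only [initialWord, List.getElem_ofFn]
  exact ne_linv_iff.1 (ω.2 i)

@[simp]
theorem length_initialWord {m : ℕ} (ω : Boundary m) (n : ℕ) :
    (initialWord ω n).length = n := by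
  simp [initialWord]

theorem mem_wordCylinder_initialWord {m : ℕ} (ω : Boundary m) (n : ℕ) :
    ω ∈ wordCylinder (initialWord ω n) := by
  intro i hi
  simp [initialWord]

theorem mem_wordCylinder_iff {m : ℕ} {ω : Boundary m} {w : List (Letter m)} :
    ω ∈ wordCylinder w ↔ initialWord ω w.length = w := by
  constructor
  · intro h
    refine List.ext_getElem (by simp) fun i h₁ h₂ => ?_
    simpa [initialWord] using h i h₂
  · intro h
    rw [← h]
    exact mem_wordCylinder_initialWord _ _

theorem mem_wordCylinder_append_iff {m : ℕ} {ω : Boundary m} {u v : List (Letter m)} :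
    ω ∈ wordCylinder (u ++ v) ↔
      ω ∈ wordCylinder u ∧ boundaryShift u.length ω ∈ wordCylinder v := by
  constructor
  · refine fun h => ⟨fun i hi => ?_, fun i hi => ?_⟩
    · rw [h i (by rw [List.length_append]; omega), List.getElem_append_left hi]
    · have := h (i + u.length) (by rw [List.length_append]; omega)
      rw [List.getElem_append_right (by omega)] at this
      simpa [boundaryShift] using this
  · rintro ⟨h₁, h₂⟩ i hi
    by_cases hu : i < u.length
    · rw [h₁ i hu, List.getElem_append_left hu]
    · have := h₂ (i - u.length) (by rw [List.length_append] at hi; omega)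
      rw [List.getElem_append_right (by omega), ← this]
      change _ = ω.1 (i - u.length + u.length)
      rw [Nat.sub_add_cancel (by omega)]

theorem wordCylinder_append_subset {m : ℕ} (u v : List (Letter m)) :
    wordCylinder (u ++ v) ⊆ wordCylinder u :=
  fun _ h => (mem_wordCylinder_append_iff.1 h).1

theorem cylinder_mk {m : ℕ} {w : List (Letter m)} (hw : IsReduced w) :
    cylinder (FreeGroup.mk w) = wordCylinder w := by
  ext ω
  have hlen : wlen (FreeGroup.mk w) = w.length := by
    rw [wlen, FreeGroup.toWord_mk, hw.reduce_eq]
  rw [mem_wordCylinder_iff, _root_.cylinder, Set.mem_ofPred_eq, hlen]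
  constructor
  · intro h
    have := FreeGroup.reduce.sound h
    rw [hw.reduce_eq] at this
    exact (isReduced_initialWord ω w.length).reduce_eq.symm.trans this
  · intro h
    exact congrArg FreeGroup.mk h

theorem measurable_coord {m : ℕ} (n : ℕ) : Measurable fun ω : Boundary m => ω.1 n :=
  (measurable_pi_apply n).comp measurable_subtype_coe

theorem measurableSet_wordCylinder {m : ℕ} (w : List (Letter m)) :
    MeasurableSet (wordCylinder w) := by
  simp only [wordCylinder, Set.ofPred_forall]
  exact MeasurableSet.iInter fun i => MeasurableSet.iInter fun h =>
    measurable_coord i (measurableSet_singleton _)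

theorem measurable_boundaryShift {m : ℕ} (k : ℕ) :
    Measurable (boundaryShift k : Boundary m → Boundary m) :=
  (measurable_pi_lambda _ fun n => measurable_coord (n + k)).subtype_mk

/-- The collection of cylinder sets of nonempty reduced words. -/
def wordCylinders (m : ℕ) : Set (Set (Boundary m)) :=
  {s | ∃ w : List (Letter m), w ≠ [] ∧ IsReduced w ∧ s = wordCylinder w}

theorem isPiSystem_wordCylinders (m : ℕ) : IsPiSystem (wordCylinders m) := by
  rintro _ ⟨u, hu, hur, rfl⟩ _ ⟨v, hv, hvr, rfl⟩ ⟨ω, hωu, hωv⟩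
  rw [mem_wordCylinder_iff] at hωu hωv
  wlog h : u.length ≤ v.length generalizing u v
  · rw [Set.inter_comm]
    exact this v hv hvr u hu hur hωv hωu (by omega)
  · refine ⟨v, hv, hvr, Set.inter_eq_right.2 fun ξ hξ i hi => ?_⟩
    rw [hξ i (by omega)]
    exact (mem_wordCylinder_iff.2 hωv i (by omega)).symm.trans (mem_wordCylinder_iff.2 hωu i hi)

theorem generateFrom_wordCylinders (m : ℕ) :
    (inferInstance : MeasurableSpace (Boundary m)) =
      MeasurableSpace.generateFrom (wordCylinders m) := by
  apply le_antisymm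
  · change MeasurableSpace.comap Subtype.val MeasurableSpace.pi ≤ _
    rw [← measurable_iff_comap_le,
      @measurable_pi_iff _ _ _ (MeasurableSpace.generateFrom (wordCylinders m))]
    refine fun n => @measurable_to_countable' _ _ _ _
      (MeasurableSpace.generateFrom (wordCylinders m)) _ fun x => ?_
    have heq : (fun ω : Boundary m => ω.1 n) ⁻¹' {x} =
        ⋃ w ∈ {w : List (Letter m) | w ≠ [] ∧ IsReduced w ∧ w[n]? = some x},
          wordCylinder w := by
      ext ω
      simp only [Set.mem_preimage, Set.mem_singleton_iff, Set.mem_iUnion]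
      constructor
      · intro h
        refine ⟨initialWord ω (n + 1), ⟨?_, isReduced_initialWord _ _, ?_⟩,
          mem_wordCylinder_initialWord _ _⟩
        · exact List.ne_nil_of_length_pos (by simp)
        · rw [List.getElem?_eq_getElem (by simp)]
          simp only [initialWord, List.getElem_ofFn, h]
      · rintro ⟨w, ⟨-, -, hwn⟩, hω⟩
        obtain ⟨hn, rfl⟩ := List.getElem?_eq_some_iff.1 hwn
        exact hω n hn
    rw [heq]
    exact @MeasurableSet.biUnion _ _ (MeasurableSpace.generateFrom (wordCylinders m)) _ _
      (Set.to_countable _) fun w hw =>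
      MeasurableSpace.measurableSet_generateFrom ⟨w, hw.1, hw.2.1, rfl⟩
  · refine MeasurableSpace.generateFrom_le ?_
    rintro _ ⟨w, -, -, rfl⟩
    exact measurableSet_wordCylinder w

theorem measure_ext_of_wordCylinder {m : ℕ} {μ ν : Measure (Boundary m)} [IsFiniteMeasure μ]
    (h : ∀ w : List (Letter m), w ≠ [] → IsReduced w →
      μ (wordCylinder w) = ν (wordCylinder w)) : μ = ν := by
  refine Measure.ext_of_generateFrom_of_cover_subset (generateFrom_wordCylinders m)
    (isPiSystem_wordCylinders m) (T := Set.range fun x : Letter m => wordCylinder [x]) ?_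
    (Set.countable_range _) ?_ ?_ ?_
  · rintro _ ⟨x, rfl⟩
    exact ⟨[x], by simp, by simp, rfl⟩
  · refine Set.eq_univ_of_forall fun ω => ⟨wordCylinder [ω.1 0], ⟨ω.1 0, rfl⟩, ?_⟩
    intro i hi
    obtain rfl : i = 0 := by simpa using hi
    rfl
  · intro s _
    exact measure_ne_top μ s
  · rintro _ ⟨w, hw, hwr, rfl⟩
    exact h w hw hwr

/-- `μ` gives every cylinder the mass prescribed by the uniform measure. -/
def IsUniform {m : ℕ} (μ : Measure (Boundary m)) : Prop :=
  ∀ g : FreeGroup (Fin m), g ≠ 1 →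
    μ (cylinder g) = ((2 * m * (2 * m - 1) ^ (wlen g - 1) : ℕ) : ℝ≥0∞)⁻¹

theorem IsUniform.measure_wordCylinder {m : ℕ} {μ : Measure (Boundary m)} (hμ : IsUniform μ)
    {w : List (Letter m)} (hw : w ≠ []) (hwr : IsReduced w) :
    μ (wordCylinder w) = ((2 * m * (2 * m - 1) ^ (w.length - 1) : ℕ) : ℝ≥0∞)⁻¹ := by
  have htw : (FreeGroup.mk w).toWord = w := by rw [FreeGroup.toWord_mk, hwr.reduce_eq]
  have h := hμ (FreeGroup.mk w) fun h1 => hw <| by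
    rw [← htw, h1, FreeGroup.toWord_one]
  rwa [cylinder_mk hwr, wlen, htw] at h

theorem IsUniform.measure_wordCylinder_append {m : ℕ} {μ : Measure (Boundary m)}
    (hμ : IsUniform μ) {u v : List (Letter m)} (hv : v ≠ []) (huv : IsReduced (u ++ v)) :
    μ (wordCylinder (u ++ v)) =
      (((2 * m - 1) ^ u.length : ℕ) : ℝ≥0∞)⁻¹ * μ (wordCylinder v) := by
  have hvr := (isReduced_append_iff.1 huv).2.1
  have hlen : 0 < v.length := List.length_pos_iff.2 hv
  rw [hμ.measure_wordCylinder (by simp [hv]) huv, hμ.measure_wordCylinder hv hvr,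
    ← ENNReal.mul_inv (.inr (ENNReal.natCast_ne_top _)) (.inl (ENNReal.natCast_ne_top _)),
    ← Nat.cast_mul]
  congr 2
  rw [List.length_append, show u.length + v.length - 1 = u.length + (v.length - 1) by omega,
    pow_add]
  ring

theorem IsUniform.measureReal_wordCylinder {m : ℕ} (hm : 2 ≤ m) {μ : Measure (Boundary m)}
    (hμ : IsUniform μ) {w : List (Letter m)} (hw : w ≠ []) (hwr : IsReduced w) :
    μ.real (wordCylinder w) * (2 * m - 1) ^ w.length = (2 * m - 1) / (2 * m) := by
  have hm' : (2 : ℝ) ≤ m := by exact_mod_cast hm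
  have hq : (2 * m - 1 : ℝ) ≠ 0 := by linarith
  obtain ⟨n, hn⟩ := Nat.exists_eq_succ_of_ne_zero (List.length_pos_iff.2 hw).ne'
  rw [measureReal_def, hμ.measure_wordCylinder hw hwr, ENNReal.toReal_inv,
    ENNReal.toReal_natCast, hn, Nat.succ_sub_one, Nat.cast_mul, Nat.cast_pow,
    Nat.cast_sub (by omega)]
  push_cast
  rw [pow_succ]
  field_simp

theorem IsUniform.map_boundaryShift {m : ℕ} {μ : Measure (Boundary m)} [IsFiniteMeasure μ]
    (hμ : IsUniform μ) {u : List (Letter m)} {x : Letter m} (hux : IsReduced (u ++ [x])) :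
    (μ.restrict (wordCylinder (u ++ [x]))).map (boundaryShift u.length) =
      (((2 * m - 1) ^ u.length : ℕ) : ℝ≥0∞)⁻¹ • μ.restrict (wordCylinder [x]) := by
  refine measure_ext_of_wordCylinder fun v hv hvr => ?_
  have hmeas := measurableSet_wordCylinder v
  rw [Measure.map_apply (measurable_boundaryShift _) hmeas,
    Measure.restrict_apply (measurable_boundaryShift _ hmeas), Measure.smul_apply,
    Measure.restrict_apply hmeas, smul_eq_mul]
  obtain ⟨y, t, rfl⟩ := List.exists_cons_of_ne_nil hv
  by_cases hxy : y = x
  · subst hxy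
    have huv : IsReduced (u ++ y :: t) := by
      rw [isReduced_append_iff] at hux ⊢
      exact ⟨hux.1, hvr, by simpa using hux.2.2⟩
    have h₁ : wordCylinder (y :: t) ∩ wordCylinder [y] = wordCylinder (y :: t) :=
      Set.inter_eq_left.2 (wordCylinder_append_subset [y] t)
    have h₂ : boundaryShift u.length ⁻¹' wordCylinder (y :: t) ∩ wordCylinder (u ++ [y]) =
        wordCylinder (u ++ y :: t) := by
      ext ω
      have := @wordCylinder_append_subset m [y] t (boundaryShift u.length ω)
      simp only [Set.mem_inter_iff, Set.mem_preimage, mem_wordCylinder_append_iff (u := u)]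
      tauto
    rw [h₁, h₂, hμ.measure_wordCylinder_append hv huv]
  · have hdisj : ∀ ω : Boundary m, ω ∈ wordCylinder (y :: t) → ω ∉ wordCylinder [x] := by
      intro ω h h'
      exact hxy ((h 0 (by simp)).symm.trans (h' 0 (by simp)))
    have h₁ : wordCylinder (y :: t) ∩ wordCylinder [x] = ∅ :=
      Set.eq_empty_of_forall_notMem fun ω h => hdisj ω h.1 h.2
    have h₂ : boundaryShift u.length ⁻¹' wordCylinder (y :: t) ∩ wordCylinder (u ++ [x]) = ∅ :=
      Set.eq_empty_of_forall_notMem fun ω h =>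
        hdisj _ h.1 (mem_wordCylinder_append_iff.1 h.2).2
    rw [h₁, h₂]
    simp

theorem boundaryShift_bact {m : ℕ} {g : FreeGroup (Fin m)} {ω : Boundary m}
    (h : bact g ω ∈ wordCylinder g.toWord) :
    boundaryShift g.toWord.length (bact g ω) = ω := by
  have hval : ∀ n, (bact g ω).1 n = actSeq g ω n := fun _ => rfl
  obtain ⟨hle, hspec⟩ := cancelLen_spec g.toWord ω.1
  have hzero : cancelLen g.toWord ω.1 = 0 := by
    by_contra hne
    set k := cancelLen g.toWord ω.1 with hk
    have h₁ := hspec (k - 1) (by omega)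
    have h₂ := h (g.toWord.length - k) (by omega)
    rw [hval, actSeq, dif_neg (by omega), ← hk,
      show g.toWord.length - k - (g.toWord.length - k) + k = k - 1 + 1 by omega] at h₂
    rw [show g.toWord.length - 1 - (k - 1) = g.toWord.length - k by omega,
      List.getElem?_eq_getElem (by omega), ← h₂, Option.some_inj] at h₁
    exact ω.2 (k - 1) h₁
  ext1
  funext n
  change actSeq g ω (n + g.toWord.length) = ω.1 n
  rw [actSeq, dif_neg (by omega), hzero, Nat.sub_zero, Nat.add_sub_cancel, Nat.add_zero]

theorem IsUniform.measureReal_inter_wordCylinder_append_le {m : ℕ} (hm : 2 ≤ m)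
    {μ : Measure (Boundary m)} [IsFiniteMeasure μ] (hμ : IsUniform μ) {E : Set (Boundary m)}
    (hE : MeasurableSet E) {g : FreeGroup (Fin m)} (hg : μ (E ∆ (bact g '' E)) = 0)
    {v : List (Letter m)} (hv : v ≠ []) (hgv : IsReduced (g.toWord ++ v)) :
    μ.real (E ∩ wordCylinder (g.toWord ++ v)) * (2 * m - 1) ^ g.toWord.length ≤
      μ.real (E ∩ wordCylinder v) := by
  obtain ⟨x, t, rfl⟩ := List.exists_cons_of_ne_nil hv
  set u := g.toWord with hu
  have hux : IsReduced (u ++ [x]) := hgv.infix ⟨[], t, by simp⟩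
  have hsub : E ∩ wordCylinder (u ++ x :: t) ⊆ E ∆ (bact g '' E) ∪
      (boundaryShift u.length ⁻¹' (E ∩ wordCylinder (x :: t)) ∩ wordCylinder (u ++ [x])) := by
    rintro ω ⟨hωE, hω⟩
    by_cases hmem : ω ∈ bact g '' E
    · right
      obtain ⟨ξ, hξ, rfl⟩ := hmem
      have hω' := mem_wordCylinder_append_iff.1 hω
      have hshift := boundaryShift_bact hω'.1
      rw [← hu] at hshift
      refine ⟨⟨?_, hω'.2⟩, ?_⟩
      · rwa [hshift]
      · refine wordCylinder_append_subset _ t ?_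
        simpa using hω
    · exact .inl (.inl ⟨hωE, hmem⟩)
  have hmeas : MeasurableSet (E ∩ wordCylinder (x :: t)) :=
    hE.inter (measurableSet_wordCylinder _)
  have hle : μ (E ∩ wordCylinder (u ++ x :: t)) ≤
      (((2 * m - 1) ^ u.length : ℕ) : ℝ≥0∞)⁻¹ * μ (E ∩ wordCylinder (x :: t)) := by
    calc μ (E ∩ wordCylinder (u ++ x :: t))
        ≤ μ (E ∆ (bact g '' E)) + μ (boundaryShift u.length ⁻¹' (E ∩ wordCylinder (x :: t)) ∩
            wordCylinder (u ++ [x])) := (measure_mono hsub).trans (measure_union_le _ _)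
      _ = ((μ.restrict (wordCylinder (u ++ [x]))).map (boundaryShift u.length))
            (E ∩ wordCylinder (x :: t)) := by
          rw [hg, zero_add, Measure.map_apply (measurable_boundaryShift _) hmeas,
            Measure.restrict_apply (measurable_boundaryShift _ hmeas)]
      _ ≤ _ := by
          rw [hμ.map_boundaryShift hux, Measure.smul_apply, smul_eq_mul]
          gcongr
          exact Measure.restrict_le_self
  have hreal := ENNReal.toReal_mono
    (ENNReal.mul_ne_top (ENNReal.inv_ne_top.2 (Nat.cast_ne_zero.2
      (pow_ne_zero _ (by omega)))) (measure_ne_top μ _)) hle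
  rw [ENNReal.toReal_mul, ENNReal.toReal_inv, ENNReal.toReal_natCast, Nat.cast_pow,
    Nat.cast_sub (by omega)] at hreal
  push_cast at hreal
  have hpos : (0 : ℝ) < (2 * m - 1) ^ u.length := by
    have : (2 : ℝ) ≤ m := by exact_mod_cast hm
    exact pow_pos (by linarith) _
  rwa [inv_mul_eq_div, le_div_iff₀ hpos] at hreal

/-- A finite index subgroup contains elements whose reduced words interpolate, with a bounded
number of letters, between an arbitrary prefix and a fixed suffix. -/
theorem exists_bounded_connecting_word {m : ℕ} (hm : 2 ≤ m) (H : Subgroup (FreeGroup (Fin m)))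
    [H.FiniteIndex] {v : List (Letter m)} (hv : v ≠ []) (hvr : IsReduced v) :
    ∃ L : ℕ, ∀ w : List (Letter m), w ≠ [] → IsReduced w → ∃ r : List (Letter m),
      r.length ≤ L ∧ IsReduced (w ++ r ++ v) ∧ FreeGroup.mk (w ++ r) ∈ H := by
  have hex : ∀ w : List (Letter m), w ≠ [] → IsReduced w → ∃ r : List (Letter m),
      IsReduced (w ++ r ++ v) ∧ FreeGroup.mk (w ++ r) ∈ H := by
    intro w hw hwr
    obtain ⟨y, hy⟩ : ∃ y : Letter m,
        y ∉ ({linv (w.getLast hw), linv (w.head hw), linv (v.head hv)} : Finset (Letter m)) := by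
      by_contra! hall
      have h₁ := Finset.card_le_card fun y (_ : y ∈ Finset.univ) => hall y
      have h₂ := Finset.card_le_three (a := linv (w.getLast hw)) (b := linv (w.head hw))
        (c := linv (v.head hv))
      simp at h₁
      omega
    simp only [Finset.mem_insert, Finset.mem_singleton, not_or] at hy
    obtain ⟨hy₁, hy₂, hy₃⟩ := hy
    have hwy : IsReduced (w ++ [y]) := by
      rw [isReduced_append_iff]
      refine ⟨hwr, .singleton, ?_⟩
      simpa [List.getLast?_eq_getLast_of_ne_nil hw] using hy₁
    have hcyc : FreeGroup.IsCyclicallyReduced (w ++ [y]) := by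
      refine ⟨hwy, ?_⟩
      simp only [← ne_linv_iff]
      simpa [List.head?_append, List.head?_eq_some_head hw] using linv_ne_symm hy₂
    have hwyv : IsReduced ([] ++ (w ++ [y]) ++ v) := by
      rw [List.nil_append, isReduced_append_iff]
      refine ⟨hwy, hvr, ?_⟩
      simpa [List.head?_eq_some_head hv] using linv_ne_symm hy₃
    obtain ⟨n, hn, -, hnH⟩ := Subgroup.exists_pow_mem_of_index_ne_zero
      (Subgroup.FiniteIndex.index_ne_zero (H := H)) (FreeGroup.mk (w ++ [y]))
    obtain ⟨k, rfl⟩ := Nat.exists_eq_succ_of_ne_zero hn.ne'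
    have hflat : w ++ (y :: (List.replicate k (w ++ [y])).flatten) =
        (List.replicate (k + 1) (w ++ [y])).flatten := by
      simp [List.replicate_succ]
    refine ⟨y :: (List.replicate k (w ++ [y])).flatten, ?_, ?_⟩
    · rw [hflat]
      simpa using IsReduced.append_flatten_replicate_append hcyc hwyv (Nat.succ_ne_zero k)
    · rw [hflat, ← FreeGroup.pow_mk]
      exact hnH
  let τ : {w : List (Letter m) // w ≠ [] ∧ IsReduced w} → (FreeGroup (Fin m) ⧸ H) × Letter m :=
    fun w => (((FreeGroup.mk w.1)⁻¹ : FreeGroup (Fin m)), w.1.getLast w.2.1)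
  have hbound : ∀ c : (FreeGroup (Fin m) ⧸ H) × Letter m, ∃ L : ℕ, ∀ w, τ w = c →
      ∃ r : List (Letter m), r.length ≤ L ∧ IsReduced (w.1 ++ r ++ v) ∧
        FreeGroup.mk (w.1 ++ r) ∈ H := by
    intro c
    by_cases hc : ∃ w₀, τ w₀ = c
    · obtain ⟨w₀, rfl⟩ := hc
      obtain ⟨r, hred, hmem⟩ := hex w₀.1 w₀.2.1 w₀.2.2
      refine ⟨r.length, fun w hw => ⟨r, le_rfl, ?_, ?_⟩⟩
      · have hlast : w.1.getLast w.2.1 = w₀.1.getLast w₀.2.1 := congrArg Prod.snd hw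
        rw [List.append_assoc, isReduced_append_iff] at hred ⊢
        refine ⟨w.2.2, hred.2.1, ?_⟩
        have := hred.2.2
        rw [List.getLast?_eq_getLast_of_ne_nil w₀.2.1] at this
        rwa [List.getLast?_eq_getLast_of_ne_nil w.2.1, hlast]
      · have hcoset := QuotientGroup.eq.1 (congrArg Prod.fst hw)
        rw [inv_inv] at hcoset
        rw [← FreeGroup.mul_mk] at hmem ⊢
        simpa only [mul_assoc, inv_mul_cancel_left] using H.mul_mem hcoset hmem
    · exact ⟨0, fun w hw => (hc ⟨w, hw⟩).elim⟩
  choose L hL using hbound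
  obtain ⟨B, hB⟩ := (Set.finite_range L).bddAbove
  refine ⟨B, fun w hw hwr => ?_⟩
  obtain ⟨r, hr, h⟩ := hL _ ⟨w, hw, hwr⟩ rfl
  exact ⟨r, hr.trans (hB ⟨_, rfl⟩), h⟩

theorem measureReal_inter_wordCylinder_le_sum {m : ℕ} (μ : Measure (Boundary m))
    [IsFiniteMeasure μ] (E : Set (Boundary m)) {w : List (Letter m)} (hw : w ≠ []) :
    μ.real (E ∩ wordCylinder w) ≤
      ∑ y ∈ Finset.univ.erase (linv (w.getLast hw)), μ.real (E ∩ wordCylinder (w ++ [y])) := by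
  refine le_trans (measureReal_mono ?_ (measure_ne_top _ _)) (measureReal_biUnion_finset_le _ _)
  rintro ω ⟨hωE, hω⟩
  have hlen := List.length_pos_iff.2 hw
  refine Set.mem_biUnion (x := ω.1 w.length) ?_ ⟨hωE, mem_wordCylinder_append_iff.2 ⟨hω, ?_⟩⟩
  · have h₁ := ω.2 (w.length - 1)
    rw [hω (w.length - 1) (by omega), show w.length - 1 + 1 = w.length by omega] at h₁
    simpa [List.getLast_eq_getElem] using h₁
  · intro i hi
    obtain rfl : i = 0 := by simpa using hi
    simp [boundaryShift]

/-- If `Φ` is bounded above by `c` and satisfies the mean value inequality over one-letter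
extensions, then the defect `c - Φ` grows at most geometrically along extensions. -/
theorem defect_append_le {m : ℕ} (hm : 2 ≤ m) {Φ : List (Letter m) → ℝ} {c : ℝ}
    (hc : ∀ w, w ≠ [] → IsReduced w → Φ w ≤ c)
    (hmean : ∀ w (hw : w ≠ []), IsReduced w →
      (2 * m - 1) * Φ w ≤ ∑ y ∈ Finset.univ.erase (linv (w.getLast hw)), Φ (w ++ [y]))
    {w : List (Letter m)} (hw : w ≠ []) (t : List (Letter m)) (hwt : IsReduced (w ++ t)) :
    c - Φ (w ++ t) ≤ (2 * m - 1) ^ t.length * (c - Φ w) := by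
  induction t generalizing w with
  | nil => simp
  | cons x t ih =>
    have hm' : (2 : ℝ) ≤ m := by exact_mod_cast hm
    have hwx : IsReduced (w ++ [x]) := hwt.infix ⟨[], t, by simp⟩
    have hwr : IsReduced w := (isReduced_append_iff.1 hwx).1
    have hlast : ∀ y : Letter m, IsReduced (w ++ [y]) ↔ y ≠ linv (w.getLast hw) := by
      intro y
      simp [isReduced_append_iff, hwr, List.getLast?_eq_getLast_of_ne_nil hw]
    have hstep : c - Φ (w ++ [x]) ≤ (2 * m - 1) * (c - Φ w) := by
      have hsum : ∑ y ∈ Finset.univ.erase (linv (w.getLast hw)), (c - Φ (w ++ [y])) ≤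
          (2 * m - 1) * (c - Φ w) := by
        rw [Finset.sum_sub_distrib, Finset.sum_const, Finset.card_erase_of_mem (Finset.mem_univ _)]
        have hcard : ((Fintype.card (Letter m) - 1 : ℕ) : ℝ) = 2 * m - 1 := by
          rw [Nat.cast_sub (by simp; omega)]
          simp [mul_comm]
        rw [Finset.card_univ, nsmul_eq_mul, hcard]
        linarith [hmean w hw hwr]
      refine le_trans ?_ hsum
      refine Finset.single_le_sum (f := fun y => c - Φ (w ++ [y])) (fun y hy => ?_) ?_
      · exact sub_nonneg.2 (hc _ (by simp) ((hlast y).2 (Finset.ne_of_mem_erase hy)))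
      · exact Finset.mem_erase.2 ⟨(hlast x).1 hwx, Finset.mem_univ _⟩
    have htail := ih (w := w ++ [x]) (by simp) (by simpa using hwt)
    rw [List.append_assoc, List.singleton_append] at htail
    refine htail.trans ?_
    rw [List.length_cons, pow_succ, mul_assoc]
    exact mul_le_mul_of_nonneg_left hstep (pow_nonneg (by linarith) _)

/-- The density of an invariant set is the same in every cylinder. -/
theorem IsUniform.exists_measureReal_inter_wordCylinder_eq {m : ℕ} (hm : 2 ≤ m)
    {μ : Measure (Boundary m)} [IsFiniteMeasure μ] (hμ : IsUniform μ)
    (H : Subgroup (FreeGroup (Fin m))) [H.FiniteIndex] {E : Set (Boundary m)}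
    (hE : MeasurableSet E) (hinv : ∀ h ∈ H, μ (E ∆ (bact h '' E)) = 0) :
    ∃ c : ℝ, ∀ w, w ≠ [] → IsReduced w →
      μ.real (E ∩ wordCylinder w) * (2 * m - 1) ^ w.length = c := by
  have hq : (1 : ℝ) ≤ 2 * m - 1 := by
    have : (2 : ℝ) ≤ m := by exact_mod_cast hm
    linarith
  set q : ℝ := 2 * m - 1 with hqdef
  set Φ : List (Letter m) → ℝ := fun w => μ.real (E ∩ wordCylinder w) * q ^ w.length with hΦ
  have hbdd : BddAbove (Φ '' {w | w ≠ [] ∧ IsReduced w}) := by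
    refine ⟨q / (2 * m), ?_⟩
    rintro _ ⟨w, ⟨hw, hwr⟩, rfl⟩
    rw [hqdef, ← hμ.measureReal_wordCylinder hm hw hwr]
    exact mul_le_mul_of_nonneg_right (measureReal_mono Set.inter_subset_right) (by positivity)
  set c := sSup (Φ '' {w | w ≠ [] ∧ IsReduced w}) with hcdef
  have hc : ∀ w, w ≠ [] → IsReduced w → Φ w ≤ c := fun w hw hwr =>
    le_csSup hbdd ⟨w, ⟨hw, hwr⟩, rfl⟩
  have hmean : ∀ w (hw : w ≠ []), IsReduced w →
      (2 * m - 1) * Φ w ≤ ∑ y ∈ Finset.univ.erase (linv (w.getLast hw)), Φ (w ++ [y]) := by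
    intro w hw _
    simp only [hΦ, List.length_append, List.length_singleton, ← Finset.sum_mul]
    rw [← hqdef, pow_succ]
    have := measureReal_inter_wordCylinder_le_sum μ E hw
    calc _ = μ.real (E ∩ wordCylinder w) * (q ^ w.length * q) := by ring
      _ ≤ _ := by gcongr
  refine ⟨c, fun v hv hvr => le_antisymm (hc v hv hvr) ?_⟩
  obtain ⟨L, hL⟩ := exists_bounded_connecting_word hm H hv hvr
  have hdefect : ∀ w, w ≠ [] → IsReduced w → c - Φ v ≤ q ^ (L + v.length) * (c - Φ w) := by
    intro w hw hwr
    obtain ⟨r, hr, hred, hmem⟩ := hL w hw hwr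
    have hwrr : IsReduced (w ++ r) := (isReduced_append_iff.1 hred).1
    have htw : (FreeGroup.mk (w ++ r)).toWord = w ++ r := by
      rw [FreeGroup.toWord_mk, hwrr.reduce_eq]
    have hle : Φ (w ++ r ++ v) ≤ Φ v := by
      have := hμ.measureReal_inter_wordCylinder_append_le hm hE (hinv _ hmem) hv
        (by rwa [htw])
      rw [htw] at this
      simp only [hΦ]
      rw [List.length_append (as := w ++ r), pow_add, ← mul_assoc]
      gcongr
    have happ := defect_append_le hm hc hmean hw (r ++ v) (by simpa using hred)
    rw [← List.append_assoc, List.length_append] at happ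
    have hnonneg := sub_nonneg.2 (hc w hw hwr)
    calc c - Φ v ≤ q ^ (r.length + v.length) * (c - Φ w) := by linarith
      _ ≤ _ := by gcongr
  by_contra! hlt
  change Φ v < c at hlt
  have hqpos : 0 < q ^ (L + v.length) := by positivity
  have hsup : c ≤ c - (c - Φ v) / q ^ (L + v.length) := by
    refine csSup_le ⟨_, v, ⟨hv, hvr⟩, rfl⟩ ?_
    rintro _ ⟨w, ⟨hw, hwr⟩, rfl⟩
    have := (div_le_iff₀' hqpos).2 (hdefect w hw hwr)
    linarith
  have := div_pos (sub_pos.2 hlt) hqpos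
  linarith

/-- **Ergodicity of the boundary action of a finite index subgroup.** -/
theorem finite_index_boundary_action_ergodic (m : ℕ) (hm : 2 ≤ m)
    (μ : Measure (Boundary m)) [IsProbabilityMeasure μ]
    (hμ : ∀ g : FreeGroup (Fin m), g ≠ 1 →
      μ (cylinder g) = ((2 * m * (2 * m - 1) ^ (wlen g - 1) : ℕ) : ℝ≥0∞)⁻¹)
    (H : Subgroup (FreeGroup (Fin m))) (hfi : H.FiniteIndex) :
    ∀ E : Set (Boundary m), MeasurableSet E →
      (∀ h : H, μ (E ∆ (bact (h : FreeGroup (Fin m)) '' E)) = 0) →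
      μ E = 0 ∨ μ E = 1 := by
  intro E hE hinv
  have hU : IsUniform μ := hμ
  obtain ⟨c, hc⟩ := hU.exists_measureReal_inter_wordCylinder_eq hm H hE
    fun h hh => hinv ⟨h, hh⟩
  have hm' : (2 : ℝ) ≤ m := by exact_mod_cast hm
  set q : ℝ := 2 * m - 1 with hq
  have hqpos : 0 < q := by linarith
  set d : ℝ := c * (2 * m) / q with hd
  have hprop : μ.restrict E = ENNReal.ofReal d • μ := by
    refine measure_ext_of_wordCylinder fun w hw hwr => ?_
    have hμw := hU.measureReal_wordCylinder hm hw hwr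
    rw [← hq] at hμw
    have hreal : μ.real (E ∩ wordCylinder w) = d * μ.real (wordCylinder w) := by
      have hpow : q ^ w.length ≠ 0 := (pow_pos hqpos _).ne'
      rw [← mul_left_inj' hpow, hc w hw hwr, mul_assoc, hμw, hd]
      field_simp
    rw [Measure.restrict_apply (measurableSet_wordCylinder w), Set.inter_comm,
      Measure.smul_apply, smul_eq_mul, ← ofReal_measureReal, hreal,
      ENNReal.ofReal_mul' measureReal_nonneg, ofReal_measureReal]
  have huniv : μ E = ENNReal.ofReal d := by
    simpa using congrArg (fun ν => ν Set.univ) hprop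
  have hcompl : 0 = ENNReal.ofReal d * μ Eᶜ := by
    simpa [hE.compl] using congrArg (fun ν => ν Eᶜ) hprop
  rcases mul_eq_zero.1 hcompl.symm with h | h
  · exact .inl (huniv.trans h)
  · exact .inr ((prob_compl_eq_zero_iff hE).1 h)
end
end

section
/- If H ≤ F is a finitely generated subgroup of infinite index, then the action of H on (∂F, μ) is completely dissipative: there exists a measurable set W ⊆ ∂F with μ(hW ∩ h′W) = 0 for all h ≠ h′ in H and μ(∂F \ ⋃_{h∈H} h·W) = 0. -/
open MeasureTheory Filter Topology
open scoped ENNReal symmDiff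

noncomputable section

namespace FreeBoundary

variable {m : ℕ}

open FreeGroup

theorem linv_ne_iff {x y : Letter m} : y ≠ linv x ↔ (x.1 = y.1 → x.2 = y.2) := by
  obtain ⟨a, b⟩ := x
  obtain ⟨c, d⟩ := y
  cases b <;> cases d <;> simp [linv, eq_comm]

theorem isReduced_ofFn (ω : Boundary m) (n : ℕ) :
    FreeGroup.IsReduced (List.ofFn fun i : Fin n => ω.1 i) := by
  rw [FreeGroup.IsReduced, List.isChain_iff_getElem]
  intro i hi
  simpa using linv_ne_iff.1 (ω.2 i)

theorem toWord_trunc (ω : Boundary m) (n : ℕ) :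
    (trunc ω n).toWord = List.ofFn fun i : Fin n => ω.1 i := by
  rw [trunc, toWord_mk, (isReduced_ofFn ω n).reduce_eq]

theorem wlen_trunc (ω : Boundary m) (n : ℕ) : wlen (trunc ω n) = n := by
  simp [wlen, toWord_trunc]

theorem trunc_eq_trunc_iff {ω η : Boundary m} {n : ℕ} :
    trunc ω n = trunc η n ↔ ∀ i < n, ω.1 i = η.1 i := by
  rw [← toWord_inj, toWord_trunc, toWord_trunc, List.ofFn_inj, funext_iff]
  exact ⟨fun h i hi => h ⟨i, hi⟩, fun h i => h i i.2⟩

theorem eq_and_forall_of_trunc_eq {ω η : Boundary m} {n k : ℕ} (h : trunc ω n = trunc η k) :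
    n = k ∧ ∀ i < n, ω.1 i = η.1 i := by
  have hnk : n = k := by rw [← wlen_trunc ω n, h, wlen_trunc]
  subst hnk
  exact ⟨rfl, trunc_eq_trunc_iff.1 h⟩

theorem take_eq_ofFn {L : List (Letter m)} {ω : ℕ → Letter m} {n : ℕ}
    (h : ∀ i < n, L[i]? = some (ω i)) : L.take n = List.ofFn fun i : Fin n => ω i := by
  apply List.ext_getElem?
  intro i
  by_cases hi : i < n
  · rw [List.getElem?_take_of_lt hi, h i hi, List.getElem?_eq_getElem (by simpa using hi)]
    simp
  · rw [List.getElem?_eq_none (by simp; omega), List.getElem?_eq_none (by simp; omega)]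

theorem ofFn_nat_add (f : ℕ → Letter m) (n k : ℕ) :
    (List.ofFn fun i : Fin (n + k) => f i) =
      (List.ofFn fun i : Fin n => f i) ++ List.ofFn fun i : Fin k => f (n + i) := by
  rw [List.ofFn_add]
  rfl

theorem linv_eq (x : Letter m) : ((x.1, !x.2) : Letter m) = linv x := rfl

/-- The letters of `g` cancelled against `ω` spell the inverse of an initial segment of `ω`. -/
theorem drop_toWord_eq_invRev (g : FreeGroup (Fin m)) (ω : Boundary m) :
    g.toWord.drop (g.toWord.length - cancelLen g.toWord ω.1) =
      invRev (List.ofFn fun i : Fin (cancelLen g.toWord ω.1) => ω.1 i) := by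
  obtain ⟨hle, hc⟩ := cancelLen_spec g.toWord ω.1
  apply List.ext_getElem
  · simp; omega
  · intro i h1 h2
    simp only [List.length_drop] at h1
    have := hc (cancelLen g.toWord ω.1 - 1 - i) (by omega)
    rw [List.getElem?_eq_getElem (by omega)] at this
    simp only [Option.some.injEq] at this
    simp only [List.getElem_drop, invRev, List.getElem_reverse, List.getElem_map, List.getElem_ofFn,
      List.length_map, List.length_ofFn, linv_eq]
    rw [← this]
    congr 1
    omega

theorem mul_trunc (g : FreeGroup (Fin m)) (ω : Boundary m) (r : ℕ) :
    g * trunc ω (cancelLen g.toWord ω.1 + r) =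
      trunc (bact g ω) (wlen g - cancelLen g.toWord ω.1 + r) := by
  obtain ⟨hle, -⟩ := cancelLen_spec g.toWord ω.1
  have hd := drop_toWord_eq_invRev g ω
  set c := cancelLen g.toWord ω.1 with hcdef
  have hg : g = mk (g.toWord.take (g.toWord.length - c)) *
      (mk (List.ofFn fun i : Fin c => ω.1 i))⁻¹ := by
    rw [inv_mk, ← hd, mul_mk, List.take_append_drop, mk_toWord]
  have h1 : trunc ω (c + r) = mk (List.ofFn fun i : Fin c => ω.1 i) *
      mk (List.ofFn fun i : Fin r => ω.1 (c + i)) := by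
    rw [trunc, ofFn_nat_add, mul_mk]
  have h2 : trunc (bact g ω) (wlen g - c + r) = mk (g.toWord.take (g.toWord.length - c)) *
      mk (List.ofFn fun i : Fin r => ω.1 (c + i)) := by
    rw [trunc, ofFn_nat_add, mul_mk]
    congr 2
    · symm
      apply take_eq_ofFn
      intro i hi
      change i < g.toWord.length - c at hi
      rw [List.getElem?_eq_getElem (by omega)]
      exact congrArg some (show (bact g ω).1 i = g.toWord[i] from dif_pos hi).symm
    · congr 1
      funext i
      have hi : ¬ wlen g - c + i < g.toWord.length - c := by simp [wlen]
      have he : wlen g - c + i - (g.toWord.length - c) + c = c + i := by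
        change g.toWord.length - c + i - _ + c = _
        omega
      exact (dif_neg hi).trans (congrArg ω.1 he)
  rw [h1, h2]
  nth_rw 1 [hg]
  group

theorem exists_mul_trunc (g : FreeGroup (Fin m)) (ω : Boundary m) {n : ℕ} (hn : wlen g ≤ n) :
    ∃ k, n ≤ k + wlen g ∧ g * trunc ω n = trunc (bact g ω) k := by
  obtain ⟨hle, -⟩ := cancelLen_spec g.toWord ω.1
  change _ ≤ wlen g at hle
  obtain ⟨r, rfl⟩ := Nat.exists_eq_add_of_le (hle.trans hn)
  exact ⟨_, by omega, mul_trunc g ω r⟩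

theorem bact_mul (g h : FreeGroup (Fin m)) (ω : Boundary m) :
    bact (g * h) ω = bact g (bact h ω) := by
  apply Subtype.ext
  funext i
  obtain ⟨k, hk, e⟩ := exists_mul_trunc h ω (n := i + 1 + 2 * wlen g + 2 * wlen h + wlen (g * h))
    (by omega)
  obtain ⟨l, hl, e'⟩ := exists_mul_trunc g (bact h ω) (n := k) (by omega)
  obtain ⟨j, hj, e''⟩ := exists_mul_trunc (g * h) ω
    (n := i + 1 + 2 * wlen g + 2 * wlen h + wlen (g * h)) (by omega)
  rw [mul_assoc, e, e'] at e''
  obtain ⟨-, hi⟩ := eq_and_forall_of_trunc_eq e''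
  exact (hi i (by omega)).symm

theorem bact_one (ω : Boundary m) : bact 1 ω = ω := by
  apply Subtype.ext
  funext i
  obtain ⟨k, hk, e⟩ := exists_mul_trunc 1 ω (n := i + 1 + wlen (1 : FreeGroup (Fin m))) (by omega)
  rw [one_mul] at e
  exact ((eq_and_forall_of_trunc_eq e).2 i (by omega)).symm

theorem bact_inv_bact (g : FreeGroup (Fin m)) (ω : Boundary m) : bact g⁻¹ (bact g ω) = ω := by
  rw [← bact_mul, inv_mul_cancel, bact_one]

theorem bact_bact_inv (g : FreeGroup (Fin m)) (ω : Boundary m) : bact g (bact g⁻¹ ω) = ω := by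
  rw [← bact_mul, mul_inv_cancel, bact_one]

theorem image_bact (g : FreeGroup (Fin m)) (s : Set (Boundary m)) :
    bact g '' s = bact g⁻¹ ⁻¹' s :=
  congrFun (Set.image_eq_preimage_of_inverse (bact_inv_bact g) (bact_bact_inv g)) s

theorem eventually_forall_lt_eq (ω : Boundary m) (n : ℕ) :
    ∀ᶠ η in 𝓝 ω, ∀ i < n, ω.1 i = η.1 i := by
  have h : ∀ᶠ η : Boundary m in 𝓝 ω, ∀ i ∈ Finset.range n, ω.1 i = η.1 i := by
    rw [Filter.eventually_all_finset]
    intro i _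
    have hc : Continuous fun η : Boundary m => η.1 i :=
      (continuous_apply i).comp continuous_subtype_val
    filter_upwards [hc.continuousAt.preimage_mem_nhds (mem_nhds_discrete.2 rfl : {ω.1 i} ∈ 𝓝 _)]
      with η hη
    exact (Set.mem_singleton_iff.1 hη).symm
  simpa using h

theorem continuous_bact (g : FreeGroup (Fin m)) : Continuous (bact g) := by
  refine Continuous.subtype_mk (continuous_pi fun i => ?_) _
  refine IsLocallyConstant.continuous ((IsLocallyConstant.iff_eventually_eq _).2 fun ω => ?_)
  filter_upwards [eventually_forall_lt_eq ω (i + 1 + wlen g)] with η hη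
  obtain ⟨k, hk, e⟩ := exists_mul_trunc g ω (n := i + 1 + wlen g) (by omega)
  obtain ⟨l, hl, e'⟩ := exists_mul_trunc g η (n := i + 1 + wlen g) (by omega)
  rw [← trunc_eq_trunc_iff.2 hη, e] at e'
  exact ((eq_and_forall_of_trunc_eq e').2 i (by omega)).symm

theorem measurable_coord (i : ℕ) : Measurable fun ω : Boundary m => ω.1 i :=
  (measurable_pi_apply i).comp measurable_subtype_coe

/-- The boundary points whose common initial segments with elements of `H` all have length
less than `n`. -/
def separatedSet (H : Subgroup (FreeGroup (Fin m))) (n : ℕ) : Set (Boundary m) :=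
  {ω | ∀ h ∈ H, ∃ i < n, h.toWord[i]? ≠ some (ω.1 i)}

theorem measurableSet_separatedSet (H : Subgroup (FreeGroup (Fin m))) (n : ℕ) :
    MeasurableSet (separatedSet H n) := by
  have : separatedSet H n = ⋂ h ∈ (H : Set (FreeGroup (Fin m))), ⋃ i ∈ Set.Iio n,
      (fun ω : Boundary m => ω.1 i) ⁻¹' {x | h.toWord[i]? ≠ some x} := by
    ext ω
    simp [separatedSet]
  rw [this]
  exact MeasurableSet.biInter (Set.to_countable _) fun h _ =>
    MeasurableSet.biUnion (Set.to_countable _) fun i _ =>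
      measurable_coord i (Set.to_countable _).measurableSet

theorem cancelLen_lt_of_mem_separatedSet {H : Subgroup (FreeGroup (Fin m))} {n : ℕ}
    {ω : Boundary m} (hω : ω ∈ separatedSet H n) {h : FreeGroup (Fin m)} (hh : h ∈ H) :
    cancelLen h.toWord ω.1 < n := by
  obtain ⟨i, hi, hne⟩ := hω h⁻¹ (inv_mem hh)
  obtain ⟨hle, hc⟩ := cancelLen_spec h.toWord ω.1
  by_contra! hn
  apply hne
  have hci := hc i (by omega)
  rw [List.getElem?_eq_getElem (by omega), Option.some.injEq] at hci
  rw [toWord_inv, List.getElem?_eq_getElem (by simp; omega)]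
  simp only [invRev, List.getElem_reverse, List.getElem_map, List.length_map, linv_eq, hci,
    linv_linv]

theorem wlen_lt_of_bact_mem_separatedSet {H : Subgroup (FreeGroup (Fin m))} {n : ℕ}
    {ω : Boundary m} (hω : ω ∈ separatedSet H n) {h : FreeGroup (Fin m)} (hh : h ∈ H)
    (hhω : bact h ω ∈ separatedSet H n) : wlen h < 2 * n := by
  have hc := cancelLen_lt_of_mem_separatedSet hω hh
  obtain ⟨i, hi, hne⟩ := hhω h hh
  by_contra! hn
  rw [wlen] at hn
  apply hne
  rw [List.getElem?_eq_getElem (by omega)]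
  have hlt : i < h.toWord.length - cancelLen h.toWord ω.1 := by omega
  exact congrArg some (show (bact h ω).1 i = h.toWord[i] from dif_pos hlt).symm

theorem finite_setOf_wlen_lt (n : ℕ) : {g : FreeGroup (Fin m) | wlen g < n}.Finite :=
  (List.finite_length_lt (Letter m) n).preimage toWord_injective.injOn

theorem bact_pow_eq_self {g : FreeGroup (Fin m)} {ω : Boundary m} (h : bact g ω = ω) (k : ℕ) :
    bact (g ^ k) ω = ω := by
  induction k with
  | zero => rw [pow_zero, bact_one]
  | succ k ih => rw [pow_succ, bact_mul, h, ih]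

theorem bact_ne_self {H : Subgroup (FreeGroup (Fin m))} {n : ℕ} {ω : Boundary m}
    (hω : ω ∈ separatedSet H n) {h : FreeGroup (Fin m)} (hh : h ∈ H) (h1 : h ≠ 1) :
    bact h ω ≠ ω := by
  intro hfix
  have hinj : Function.Injective fun k : ℕ => h ^ k := by
    rw [injective_pow_iff_not_isOfFinOrder, isOfFinOrder_iff_eq_one]
    exact h1
  refine Set.infinite_range_of_injective hinj ((finite_setOf_wlen_lt (2 * n)).subset ?_)
  rintro _ ⟨k, rfl⟩
  refine wlen_lt_of_bact_mem_separatedSet hω (pow_mem hh k) ?_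
  rwa [bact_pow_eq_self hfix]

/-- A set is wandering if its translates by nontrivial elements of `H` are disjoint from it. -/
def IsWandering (H : Subgroup (FreeGroup (Fin m))) (V : Set (Boundary m)) : Prop :=
  ∀ h ∈ H, h ≠ 1 → ∀ ω ∈ V, bact h ω ∉ V

theorem exists_isOpen_disjoint (g : FreeGroup (Fin m)) {ω : Boundary m} (h : bact g ω ≠ ω) :
    ∃ U ∈ 𝓝 ω, ∀ η ∈ U, bact g η ∉ U := by
  obtain ⟨A, B, hA, hB, hωA, hωB, hAB⟩ := t2_separation h
  refine ⟨bact g ⁻¹' A ∩ B, Filter.inter_mem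
    ((continuous_bact g).continuousAt.preimage_mem_nhds (hA.mem_nhds hωA)) (hB.mem_nhds hωB), ?_⟩
  rintro η ⟨hη, -⟩ ⟨-, hη'⟩
  exact Set.disjoint_left.1 hAB hη hη'

theorem exists_nhds_isWandering {H : Subgroup (FreeGroup (Fin m))} {n : ℕ} {ω : Boundary m}
    (hω : ω ∈ separatedSet H n) :
    ∃ U ∈ 𝓝 ω, IsWandering H (U ∩ separatedSet H n) := by
  have hex : ∀ h : FreeGroup (Fin m), ∃ U ∈ 𝓝 ω, h ∈ H → h ≠ 1 → ∀ η ∈ U, bact h η ∉ U := by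
    intro h
    by_cases hh : h ∈ H ∧ h ≠ 1
    · obtain ⟨U, hU, hd⟩ := exists_isOpen_disjoint h (bact_ne_self hω hh.1 hh.2)
      exact ⟨U, hU, fun _ _ => hd⟩
    · exact ⟨Set.univ, Filter.univ_mem, fun h1 h2 => absurd ⟨h1, h2⟩ hh⟩
  choose U hU hd using hex
  refine ⟨⋂ h ∈ {g : FreeGroup (Fin m) | wlen g < 2 * n}, U h,
    (Filter.biInter_mem (finite_setOf_wlen_lt _)).2 fun h _ => hU h, ?_⟩
  rintro h hh h1 η ⟨hηU, hηs⟩ ⟨hhU, hhs⟩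
  have hlt := wlen_lt_of_bact_mem_separatedSet hηs hh hhs
  exact hd h hh h1 η (Set.mem_iInter₂.1 hηU h hlt) (Set.mem_iInter₂.1 hhU h hlt)

instance : SecondCountableTopology (Boundary m) :=
  TopologicalSpace.Subtype.secondCountableTopology _

theorem exists_seq_isWandering (H : Subgroup (FreeGroup (Fin m))) :
    ∃ V : ℕ → Set (Boundary m), (∀ i, MeasurableSet (V i)) ∧ (∀ i, IsWandering H (V i)) ∧
      ⋃ n, separatedSet H n ⊆ ⋃ i, V i := by
  let B := TopologicalSpace.countableBasis (Boundary m)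
  let 𝒱 : Set (Set (Boundary m)) :=
    insert ∅ ({V | IsWandering H V} ∩ ⋃ n, (fun U => U ∩ separatedSet H n) '' B)
  have hcount : 𝒱.Countable := ((Set.countable_iUnion fun n =>
    (TopologicalSpace.countable_countableBasis _).image _).mono Set.inter_subset_right).insert _
  obtain ⟨V, hV⟩ := hcount.exists_eq_range ⟨∅, Set.mem_insert _ _⟩
  have hmem : ∀ i, V i ∈ 𝒱 := fun i => hV ▸ Set.mem_range_self i
  refine ⟨V, fun i => ?_, fun i => ?_, ?_⟩
  · rcases hmem i with h | ⟨-, h⟩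
    · rw [h]; exact MeasurableSet.empty
    · obtain ⟨n, U, hU, h⟩ := Set.mem_iUnion.1 h
      rw [← h]
      exact (TopologicalSpace.isOpen_of_mem_countableBasis hU).measurableSet.inter
        (measurableSet_separatedSet H n)
  · rcases hmem i with h | ⟨h, -⟩
    · rw [h]; exact fun _ _ _ _ hω => absurd hω (Set.notMem_empty _)
    · exact h
  · rintro ω hω
    obtain ⟨n, hn⟩ := Set.mem_iUnion.1 hω
    obtain ⟨U, hU, hw⟩ := exists_nhds_isWandering hn
    obtain ⟨U', hU'B, hωU', hsub⟩ :=
      (TopologicalSpace.isBasis_countableBasis (Boundary m)).mem_nhds_iff.1 hU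
    have hin : U' ∩ separatedSet H n ∈ 𝒱 := by
      refine Or.inr ⟨?_, Set.mem_iUnion.2 ⟨n, U', hU'B, rfl⟩⟩
      exact fun h hh h1 η hη hη' => hw h hh h1 η ⟨hsub hη.1, hη.2⟩ ⟨hsub hη'.1, hη'.2⟩
    rw [hV] at hin
    obtain ⟨i, hi⟩ := hin
    exact Set.mem_iUnion.2 ⟨i, hi ▸ ⟨hωU', hn⟩⟩

/-- The saturation of a set under the action of `H`. -/
def saturation (H : Subgroup (FreeGroup (Fin m))) (V : Set (Boundary m)) : Set (Boundary m) :=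
  ⋃ h : H, bact (h : FreeGroup (Fin m)) '' V

theorem mem_saturation {H : Subgroup (FreeGroup (Fin m))} {V : Set (Boundary m)}
    {ω : Boundary m} : ω ∈ saturation H V ↔ ∃ h ∈ H, ∃ η ∈ V, bact h η = ω := by
  simp [saturation]

theorem bact_mem_saturation {H : Subgroup (FreeGroup (Fin m))} {V : Set (Boundary m)}
    {ω : Boundary m} {h : FreeGroup (Fin m)} (hh : h ∈ H) (hω : ω ∈ saturation H V) :
    bact h ω ∈ saturation H V := by
  obtain ⟨k, hk, η, hη, rfl⟩ := mem_saturation.1 hω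
  exact mem_saturation.2 ⟨h * k, mul_mem hh hk, η, hη, bact_mul h k η⟩

theorem subset_saturation (H : Subgroup (FreeGroup (Fin m))) (V : Set (Boundary m)) :
    V ⊆ saturation H V :=
  fun ω hω => mem_saturation.2 ⟨1, one_mem H, ω, hω, bact_one ω⟩

theorem measurableSet_saturation (H : Subgroup (FreeGroup (Fin m))) {V : Set (Boundary m)}
    (hV : MeasurableSet V) : MeasurableSet (saturation H V) := by
  refine MeasurableSet.iUnion fun h => ?_
  rw [image_bact]
  exact (continuous_bact _).measurable hV

/-- A countable family of wandering sets can be refined to a single fundamental set. -/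
theorem exists_fundamental_set (H : Subgroup (FreeGroup (Fin m))) (V : ℕ → Set (Boundary m))
    (hV : ∀ i, MeasurableSet (V i)) (hw : ∀ i, IsWandering H (V i)) :
    ∃ W : Set (Boundary m), MeasurableSet W ∧
      (∀ h h' : H, h ≠ h' → Disjoint (bact (h : FreeGroup (Fin m)) '' W)
        (bact (h' : FreeGroup (Fin m)) '' W)) ∧
      ⋃ i, V i ⊆ ⋃ h : H, bact (h : FreeGroup (Fin m)) '' W := by
  refine ⟨⋃ i, V i \ ⋃ j ∈ Set.Iio i, saturation H (V j), ?_, ?_, ?_⟩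
  · exact MeasurableSet.iUnion fun i => (hV i).diff
      (MeasurableSet.biUnion (Set.to_countable _) fun j _ => measurableSet_saturation H (hV j))
  · intro h h' hne
    rw [Set.disjoint_left]
    rintro _ ⟨ω, hω, rfl⟩ ⟨η, hη, he⟩
    obtain ⟨i, hωi, hωn⟩ := Set.mem_iUnion.1 hω
    obtain ⟨j, hηj, hηn⟩ := Set.mem_iUnion.1 hη
    have hk : ((h' : FreeGroup (Fin m))⁻¹ * (h : FreeGroup (Fin m))) ∈ H := mul_mem (inv_mem h'.2) h.2
    have hη : bact ((h' : FreeGroup (Fin m))⁻¹ * (h : FreeGroup (Fin m))) ω = η := by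
      rw [bact_mul, ← he, bact_inv_bact]
    rcases lt_trichotomy i j with hij | rfl | hij
    · apply hηn
      rw [← hη]
      exact Set.mem_biUnion hij (bact_mem_saturation hk (subset_saturation H _ hωi))
    · refine hw i _ hk (fun h1 => hne ?_) ω hωi (hη ▸ hηj)
      exact Subtype.ext (inv_mul_eq_one.1 h1).symm
    · apply hωn
      rw [← bact_inv_bact ((h' : FreeGroup (Fin m))⁻¹ * (h : FreeGroup (Fin m))) ω, hη]
      exact Set.mem_biUnion hij (bact_mem_saturation (inv_mem hk) (subset_saturation H _ hηj))
  · intro ω hω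
    obtain ⟨i₀, hi₀⟩ := Set.mem_iUnion.1 hω
    have hex : ∃ i, ω ∈ saturation H (V i) := ⟨i₀, subset_saturation H _ hi₀⟩
    classical
    obtain ⟨h, hh, η, hη, he⟩ := mem_saturation.1 (Nat.find_spec hex)
    refine Set.mem_iUnion.2 ⟨⟨h, hh⟩, η, Set.mem_iUnion.2 ⟨_, hη, fun hcon => ?_⟩, he⟩
    obtain ⟨j, hj, hηj⟩ := Set.mem_iUnion₂.1 hcon
    exact Nat.find_min hex hj (he ▸ bact_mem_saturation hh hηj)

/-- The elements of the free group represented by initial segments of the reduced word of `g`. -/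
def initials (g : FreeGroup (Fin m)) : Set (FreeGroup (Fin m)) :=
  Set.range fun n => mk (g.toWord.take n)

theorem finite_initials (g : FreeGroup (Fin m)) : (initials g).Finite := by
  refine ((Set.finite_Iic g.toWord.length).image fun n => mk (g.toWord.take n)).subset ?_
  rintro _ ⟨n, rfl⟩
  rcases le_total n g.toWord.length with h | h
  · exact ⟨n, h, rfl⟩
  · refine ⟨g.toWord.length, Set.mem_Iic.2 le_rfl, ?_⟩
    simp [List.take_of_length_le h]

theorem toWord_mul_of_forall {g v : FreeGroup (Fin m)}
    (h : ∀ x ∈ g.toWord.getLast?, ∀ y ∈ v.toWord.head?, y ≠ linv x) :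
    (g * v).toWord = g.toWord ++ v.toWord := by
  rw [toWord_mul]
  refine FreeGroup.IsReduced.reduce_eq
    (List.isChain_append.2 ⟨isReduced_toWord, isReduced_toWord, ?_⟩)
  exact fun x hx y hy => linv_ne_iff.1 (h x hx y hy)

theorem toWord_mk_singleton (x : Letter m) : (mk [x]).toWord = [x] := by
  rw [toWord_mk, reduce_singleton]

theorem initials_mul_mk_singleton (g : FreeGroup (Fin m)) (x : Letter m) :
    initials (g * mk [x]) ⊆ insert (g * mk [x]) (initials g) := by
  rintro _ ⟨n, rfl⟩
  dsimp only
  by_cases h : ∀ z ∈ g.toWord.getLast?, x ≠ linv z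
  · have hw : (g * mk [x]).toWord = g.toWord ++ [x] := by
      rw [toWord_mul_of_forall, toWord_mk_singleton]
      intro z hz y hy
      rw [toWord_mk_singleton] at hy
      obtain rfl : x = y := by simpa using hy
      exact h z hz
    rcases le_or_gt n g.toWord.length with hn | hn
    · right
      rw [hw, List.take_append_of_le_length hn]
      exact ⟨n, rfl⟩
    · left
      rw [List.take_of_length_le (by rw [hw]; simp; omega), mk_toWord]
  · push Not at h
    obtain ⟨z, hz, rfl⟩ := h
    obtain ⟨L, hL⟩ := List.mem_getLast?_eq_getLast hz |>.elim fun hne he =>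
      (⟨g.toWord.dropLast, he ▸ (List.dropLast_append_getLast hne).symm⟩ :
        ∃ L, g.toWord = L ++ [z])
    have hred : FreeGroup.IsReduced L :=
      (List.isChain_append.1 (hL ▸ isReduced_toWord (x := g) :
        FreeGroup.IsReduced (L ++ [z]))).1
    have hg : g * mk [linv z] = mk L := by
      have hz : (mk [linv z] : FreeGroup (Fin m)) = (mk [z])⁻¹ := by
        rw [inv_mk]; rfl
      rw [hz, mul_inv_eq_iff_eq_mul, mul_mk, ← hL, mk_toWord]
    right
    refine ⟨min n L.length, ?_⟩
    dsimp only
    rw [hg, toWord_mk, hred.reduce_eq, hL, List.take_append_of_le_length (min_le_right _ _)]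
    exact congrArg mk List.take_eq_take_min.symm

theorem initials_mul_mk (L : List (Letter m)) (g : FreeGroup (Fin m)) :
    initials (g * mk L) ⊆ initials g ∪ Set.range fun j => g * mk (L.take j) := by
  induction L generalizing g with
  | nil =>
    rw [← one_eq_mk, mul_one]
    exact Set.subset_union_left
  | cons x L ih =>
    have hx : ∀ L' : List (Letter m), g * mk (x :: L') = g * mk [x] * mk L' := fun L' => by
      rw [mul_assoc, mul_mk, List.singleton_append]
    rw [hx]
    intro p hp
    rcases ih _ hp with hp | ⟨j, rfl⟩
    · rcases initials_mul_mk_singleton g x hp with rfl | hp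
      · exact Or.inr ⟨1, rfl⟩
      · exact Or.inl hp
    · exact Or.inr ⟨j + 1, hx _⟩

/-- The right coset `H g`, encoded as the left coset `g⁻¹ H`. -/
def rightCoset (H : Subgroup (FreeGroup (Fin m))) (g : FreeGroup (Fin m)) :
    FreeGroup (Fin m) ⧸ H :=
  ((g⁻¹ : FreeGroup (Fin m)) : FreeGroup (Fin m) ⧸ H)

theorem rightCoset_mul (H : Subgroup (FreeGroup (Fin m))) (g v : FreeGroup (Fin m)) :
    rightCoset H (g * v) = v⁻¹ • rightCoset H g := by
  rw [rightCoset, mul_inv_rev]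
  rfl

theorem rightCoset_mul_of_mem {H : Subgroup (FreeGroup (Fin m))} {h : FreeGroup (Fin m)}
    (hh : h ∈ H) (g : FreeGroup (Fin m)) : rightCoset H (h * g) = rightCoset H g := by
  rw [rightCoset, rightCoset, QuotientGroup.eq]
  simpa using hh

/-- The core of the Schreier graph of a finitely generated subgroup is finite. -/
theorem exists_finite_core {H : Subgroup (FreeGroup (Fin m))} (hfg : H.FG) :
    ∃ K : Set (FreeGroup (Fin m) ⧸ H), K.Finite ∧
      ∀ h ∈ H, ∀ p ∈ initials h, rightCoset H p ∈ K := by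
  obtain ⟨S, hS⟩ := hfg
  let P : Set (FreeGroup (Fin m)) :=
    initials 1 ∪ ⋃ s ∈ S, (initials s ∪ initials s⁻¹)
  have hP : P.Finite := (finite_initials 1).union
    (S.finite_toSet.biUnion fun s _ => (finite_initials s).union (finite_initials s⁻¹))
  refine ⟨rightCoset H '' P, hP.image _, fun h hh => ?_⟩
  have step : ∀ x ∈ H, ∀ y : FreeGroup (Fin m), initials y ⊆ P →
      (∀ p ∈ initials x, rightCoset H p ∈ rightCoset H '' P) →
      ∀ p ∈ initials (x * y), rightCoset H p ∈ rightCoset H '' P := by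
    intro x hx y hy ih p hp
    rw [← mk_toWord (x := y)] at hp
    rcases initials_mul_mk _ _ hp with hp | ⟨j, rfl⟩
    · exact ih p hp
    · rw [rightCoset_mul_of_mem hx]
      exact Set.mem_image_of_mem _ (hy ⟨j, rfl⟩)
  have hPS : ∀ y ∈ S, initials y ∪ initials y⁻¹ ⊆ P := fun y hy =>
    (Set.subset_biUnion_of_mem (u := fun s => initials s ∪ initials s⁻¹)
      (Finset.mem_coe.2 hy)).trans Set.subset_union_right
  rw [← hS] at hh
  induction hh using Subgroup.closure_induction_right with
  | one => exact fun p hp => Set.mem_image_of_mem _ (Or.inl hp)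
  | mul_right x hx y hy ih =>
    exact step x (hS ▸ hx) y (Set.subset_union_left.trans (hPS y hy)) ih
  | mul_inv_cancel x hx y hy ih =>
    exact step x (hS ▸ hx) y⁻¹ (Set.subset_union_right.trans (hPS y hy)) ih

/-- From any vertex of an infinite Schreier graph, a finite set of vertices can be left along a
reduced path with prescribed forbidden first letter. -/
theorem exists_escape (hm : 2 ≤ m) {H : Subgroup (FreeGroup (Fin m))}
    [Infinite (FreeGroup (Fin m) ⧸ H)] {K : Set (FreeGroup (Fin m) ⧸ H)} (hK : K.Finite)
    (c : FreeGroup (Fin m) ⧸ H) (x : Letter m) :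
    ∃ v : FreeGroup (Fin m), (∀ y ∈ v.toWord.head?, y ≠ linv x) ∧ v⁻¹ • c ∉ K := by
  by_contra! hcon
  have : Nontrivial (Fin m) := Fin.nontrivial_iff_two_le.2 hm
  obtain ⟨a, ha⟩ := exists_ne x.1
  have hhead : ∀ n, ∀ y ∈ ((of a : FreeGroup (Fin m)) ^ n).toWord.head?, y = (a, true) := by
    intro n y hy
    rw [toWord_of_pow] at hy
    exact List.eq_of_mem_replicate (List.mem_of_mem_head? hy)
  have hmem : ∀ n : ℕ, ((of a : FreeGroup (Fin m)) ^ n)⁻¹ • c ∈ K := fun n =>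
    hcon _ fun y hy h => ha (by rw [hhead n y hy] at h; exact congrArg Prod.fst h)
  obtain ⟨i, -, j, -, hij, he⟩ := Set.infinite_univ.exists_lt_map_eq_of_mapsTo
    (f := fun n : ℕ => ((of a : FreeGroup (Fin m)) ^ n)⁻¹ • c) (fun n _ => hmem n) hK
  obtain ⟨d, rfl⟩ := Nat.exists_eq_add_of_lt hij
  have hfix : ((of a : FreeGroup (Fin m)) ^ (d + 1))⁻¹ • c = c := by
    rw [show i + d + 1 = (d + 1) + i by omega, pow_add, mul_inv_rev, mul_smul] at he
    exact (MulAction.injective _ he).symm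
  refine Set.infinite_univ (hK.subset fun q _ => ?_)
  obtain ⟨f', hf'⟩ := MulAction.exists_smul_eq (FreeGroup (Fin m)) c q
  obtain ⟨f, rfl⟩ : ∃ f, f' = f⁻¹ := ⟨f'⁻¹, by simp⟩
  by_cases hf : ∀ y ∈ f.toWord.head?, y ≠ linv x
  · exact hf' ▸ hcon f hf
  · push Not at hf
    have hw : ((of a : FreeGroup (Fin m)) ^ (d + 1) * f).toWord =
        List.replicate (d + 1) (a, true) ++ f.toWord := by
      rw [toWord_mul_of_forall, toWord_of_pow]
      intro y hy z hz hzy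
      obtain ⟨w, hw, rfl⟩ := hf
      obtain rfl : linv x = z := Option.some_injective _ (hw.symm.trans hz)
      rw [toWord_of_pow] at hy
      have := List.eq_of_mem_replicate (List.mem_of_mem_getLast? hy)
      subst this
      exact ha (congrArg Prod.fst hzy).symm
    rw [← hf', ← hfix, ← mul_smul, ← mul_inv_rev]
    refine hcon _ fun y hy h => ha ?_
    rw [hw, List.replicate_succ] at hy
    obtain rfl : (a, true) = y := by simpa using hy
    exact congrArg Prod.fst h

theorem isOpen_setOf_trunc_mem (n : ℕ) (s : Set (FreeGroup (Fin m))) :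
    IsOpen {ω : Boundary m | trunc ω n ∈ s} := by
  refine isOpen_iff_mem_nhds.2 fun ω hω => ?_
  filter_upwards [eventually_forall_lt_eq ω n] with η hη
  rw [← trunc_eq_trunc_iff.2 hη]
  exact hω

theorem measurableSet_cylinder (g : FreeGroup (Fin m)) : MeasurableSet (cylinder g) :=
  (isOpen_setOf_trunc_mem (wlen g) {g}).measurableSet

theorem mem_cylinder_trunc {ω η : Boundary m} {n : ℕ} :
    ω ∈ cylinder (trunc η n) ↔ trunc ω n = trunc η n := by
  change trunc ω (wlen (trunc η n)) = trunc η n ↔ _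
  rw [wlen_trunc]

theorem cylinder_mul_subset {g v : FreeGroup (Fin m)}
    (h : (g * v).toWord = g.toWord ++ v.toWord) : cylinder (g * v) ⊆ cylinder g := by
  intro ω hω
  have hl : wlen (g * v) = wlen g + wlen v := by simp [wlen, h]
  have hω' : trunc ω (wlen g + wlen v) = g * v := hl ▸ hω
  have := congrArg toWord hω'
  rw [toWord_trunc, h, ofFn_nat_add] at this
  have := (List.append_inj this (by simp [wlen])).1
  rw [← toWord_trunc, toWord_inj] at this
  exact this

/-- The boundary points whose path in the Schreier graph stays in `K`. -/
def trappedSet (H : Subgroup (FreeGroup (Fin m))) (K : Set (FreeGroup (Fin m) ⧸ H)) :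
    Set (Boundary m) :=
  {ω | ∀ n, rightCoset H (trunc ω n) ∈ K}

theorem measurableSet_trappedSet (H : Subgroup (FreeGroup (Fin m)))
    (K : Set (FreeGroup (Fin m) ⧸ H)) : MeasurableSet (trappedSet H K) := by
  have : trappedSet H K = ⋂ n, {ω | trunc ω n ∈ rightCoset H ⁻¹' K} := by
    ext ω
    simp [trappedSet]
  rw [this]
  exact MeasurableSet.iInter fun n => (isOpen_setOf_trunc_mem n _).measurableSet

theorem compl_iUnion_separatedSet_subset {H : Subgroup (FreeGroup (Fin m))}
    {K : Set (FreeGroup (Fin m) ⧸ H)}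
    (hK : ∀ h ∈ H, ∀ p ∈ initials h, rightCoset H p ∈ K) :
    (⋃ n, separatedSet H n)ᶜ ⊆ trappedSet H K := by
  intro ω hω n
  have hn : ω ∉ separatedSet H n := fun h => hω (Set.mem_iUnion.2 ⟨n, h⟩)
  simp only [separatedSet, Set.mem_ofPred_eq] at hn
  push Not at hn
  obtain ⟨h, hh, hp⟩ := hn
  refine hK h hh _ ⟨n, ?_⟩
  dsimp only
  rw [take_eq_ofFn hp, trunc]

theorem measure_trappedSet_inter_cylinder_le (hm : 2 ≤ m) (μ : Measure (Boundary m))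
    (hμ : ∀ g : FreeGroup (Fin m), g ≠ 1 →
      μ (cylinder g) = ((2 * m * (2 * m - 1) ^ (wlen g - 1) : ℕ) : ℝ≥0∞)⁻¹)
    {H : Subgroup (FreeGroup (Fin m))} [Infinite (FreeGroup (Fin m) ⧸ H)]
    {K : Set (FreeGroup (Fin m) ⧸ H)} (hK : K.Finite) :
    ∃ ε : ℝ≥0∞, ε ≠ 0 ∧ ∀ g : FreeGroup (Fin m), g ≠ 1 → rightCoset H g ∈ K →
      μ (trappedSet H K ∩ cylinder g) + ε * μ (cylinder g) ≤ μ (cylinder g) := by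
  choose v hv hvK using fun (c : FreeGroup (Fin m) ⧸ H) (x : Letter m) => exists_escape hm hK c x
  obtain ⟨L, hL⟩ : ∃ L, ∀ c ∈ K, ∀ x, wlen (v c x) ≤ L := by
    obtain ⟨L, hL⟩ := ((hK.prod (Set.finite_univ (α := Letter m))).image
      fun p => wlen (v p.1 p.2)).bddAbove
    exact ⟨L, fun c hc x => hL ⟨(c, x), ⟨hc, Set.mem_univ _⟩, rfl⟩⟩
  have hq : 1 ≤ 2 * m - 1 := by omega
  refine ⟨(((2 * m - 1) ^ L : ℕ) : ℝ≥0∞)⁻¹, ENNReal.inv_ne_zero.2 (ENNReal.natCast_ne_top _),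
    fun g hg hgK => ?_⟩
  have hne : g.toWord ≠ [] := fun h => hg (toWord_eq_nil_iff.1 h)
  have hlen : 0 < wlen g := List.length_pos_iff.2 hne
  set x := g.toWord.getLast hne with hx
  set u := v (rightCoset H g) x with hu
  have hw : (g * u).toWord = g.toWord ++ u.toWord := toWord_mul_of_forall fun z hz => by
    rw [List.getLast?_eq_getLast_of_ne_nil hne] at hz
    obtain rfl : x = z := Option.some_injective _ hz
    exact hv _ _
  have hwlen : wlen (g * u) = wlen g + wlen u := by simp [wlen, hw]
  have hgu : g * u ≠ 1 := fun h => by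
    rw [h] at hwlen
    have h0 : wlen (1 : FreeGroup (Fin m)) = 0 := by simp [wlen]
    omega
  have hle : (((2 * m - 1) ^ L : ℕ) : ℝ≥0∞)⁻¹ * μ (cylinder g) ≤ μ (cylinder (g * u)) := by
    rw [hμ g hg, hμ _ hgu, hwlen, ← ENNReal.mul_inv (Or.inr (ENNReal.natCast_ne_top _))
      (Or.inl (ENNReal.natCast_ne_top _)), ENNReal.inv_le_inv, ← Nat.cast_mul, Nat.cast_le]
    calc 2 * m * (2 * m - 1) ^ (wlen g + wlen u - 1)
        ≤ 2 * m * (2 * m - 1) ^ (L + (wlen g - 1)) := by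
          have : wlen u ≤ L := hL _ hgK x
          exact Nat.mul_le_mul_left _ (Nat.pow_le_pow_right hq (by omega))
      _ = (2 * m - 1) ^ L * (2 * m * (2 * m - 1) ^ (wlen g - 1)) := by
          rw [pow_add]; ring
  have hdisj : Disjoint (trappedSet H K ∩ cylinder g) (cylinder (g * u)) := by
    refine Set.disjoint_left.2 fun ω hω hωu => hvK (rightCoset H g) x ?_
    have := hω.1 (wlen (g * u))
    rwa [show trunc ω (wlen (g * u)) = g * u from hωu, rightCoset_mul] at this
  calc μ (trappedSet H K ∩ cylinder g) + (((2 * m - 1) ^ L : ℕ) : ℝ≥0∞)⁻¹ * μ (cylinder g)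
      ≤ μ (trappedSet H K ∩ cylinder g) + μ (cylinder (g * u)) := by gcongr
    _ = μ (trappedSet H K ∩ cylinder g ∪ cylinder (g * u)) :=
        (measure_union hdisj (measurableSet_cylinder _)).symm
    _ ≤ μ (cylinder g) :=
        measure_mono (Set.union_subset Set.inter_subset_right (cylinder_mul_subset hw))

/-- A set given by conditions on all finite truncations is null if it misses a definite proportion
of every cylinder it meets. -/
theorem measure_eq_zero_of_cylinder_bound (μ : Measure (Boundary m)) [IsFiniteMeasure μ]
    {s : Set (Boundary m)} (hs : MeasurableSet s)
    (hclosed : ∀ ω, (∀ n, ∃ η ∈ s, trunc ω n = trunc η n) → ω ∈ s) {ε : ℝ≥0∞} (hε : ε ≠ 0)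
    (hbound : ∀ ω ∈ s, ∀ n, n ≠ 0 → μ (s ∩ cylinder (trunc ω n)) + ε * μ (cylinder (trunc ω n)) ≤
      μ (cylinder (trunc ω n))) : μ s = 0 := by
  let G : ℕ → Set (FreeGroup (Fin m)) := fun n => (fun ω => trunc ω n) '' s
  let D : ℕ → Set (Boundary m) := fun n => {ω | trunc ω n ∈ G n}
  have hDm : ∀ n, MeasurableSet (D n) := fun n => (isOpen_setOf_trunc_mem n _).measurableSet
  have hsD : ∀ n, s ⊆ D n := fun n ω hω => ⟨ω, hω, rfl⟩
  have hanti : Antitone D := by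
    rintro n k hnk ω ⟨η, hη, he⟩
    exact ⟨η, hη, trunc_eq_trunc_iff.2 fun i hi => trunc_eq_trunc_iff.1 he i (hi.trans_le hnk)⟩
  have hD : ∀ n, D n = ⋃ g ∈ G n, cylinder g := by
    intro n
    ext ω
    rw [Set.mem_iUnion₂]
    constructor
    · rintro ⟨η, hη, he⟩
      exact ⟨_, ⟨η, hη, rfl⟩, mem_cylinder_trunc.2 he.symm⟩
    · rintro ⟨_, ⟨η, hη, rfl⟩, he⟩
      exact ⟨η, hη, (mem_cylinder_trunc.1 he).symm⟩
  have hpd : ∀ n, (G n).PairwiseDisjoint cylinder := by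
    rintro n _ ⟨η, -, rfl⟩ _ ⟨η', -, rfl⟩ hne
    refine Set.disjoint_left.2 fun ω h h' => hne ?_
    exact (mem_cylinder_trunc.1 h).symm.trans (mem_cylinder_trunc.1 h')
  have hle : ∀ n, n ≠ 0 → μ s + ε * μ s ≤ μ (D n) := by
    intro n hn
    have h1 : μ (D n) = ∑' g : G n, μ (cylinder (g : FreeGroup (Fin m))) := by
      rw [hD, measure_biUnion (Set.to_countable _) (hpd n) fun g _ => measurableSet_cylinder g]
    have h2 : μ s = ∑' g : G n, μ (s ∩ cylinder (g : FreeGroup (Fin m))) := by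
      rw [← measure_biUnion (Set.to_countable _)
        (fun g hg g' hg' hne => (hpd n hg hg' hne).mono Set.inter_subset_right Set.inter_subset_right)
        fun g _ => hs.inter (measurableSet_cylinder g), ← Set.inter_iUnion₂, ← hD,
        Set.inter_eq_self_of_subset_left (hsD n)]
    calc μ s + ε * μ s ≤ μ s + ε * μ (D n) := by gcongr; exact hsD n
      _ ≤ μ (D n) := by
        rw [h1, h2, ← ENNReal.tsum_mul_left, ← ENNReal.tsum_add]
        refine ENNReal.tsum_le_tsum ?_
        rintro ⟨_, ω, hω, rfl⟩
        exact hbound ω hω n hn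
  have hlim := tendsto_measure_iInter_atTop (μ := μ) (fun n => (hDm n).nullMeasurableSet) hanti
    ⟨0, measure_ne_top _ _⟩
  have hsub : ⋂ n, D n ⊆ s := fun ω hω => hclosed ω fun n => by
    obtain ⟨η, hη, he⟩ := Set.mem_iInter.1 hω n
    exact ⟨η, hη, he.symm⟩
  have hfin : μ s + ε * μ s ≤ μ s :=
    (ge_of_tendsto hlim ((eventually_ne_atTop 0).mono hle)).trans (measure_mono hsub)
  by_contra h0
  exact hfin.not_gt (ENNReal.lt_add_right (measure_ne_top _ _) (mul_ne_zero hε h0))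

theorem measure_trappedSet_eq_zero (hm : 2 ≤ m) (μ : Measure (Boundary m)) [IsFiniteMeasure μ]
    (hμ : ∀ g : FreeGroup (Fin m), g ≠ 1 →
      μ (cylinder g) = ((2 * m * (2 * m - 1) ^ (wlen g - 1) : ℕ) : ℝ≥0∞)⁻¹)
    {H : Subgroup (FreeGroup (Fin m))} [Infinite (FreeGroup (Fin m) ⧸ H)]
    {K : Set (FreeGroup (Fin m) ⧸ H)} (hK : K.Finite) : μ (trappedSet H K) = 0 := by
  obtain ⟨ε, hε, hbound⟩ := measure_trappedSet_inter_cylinder_le hm μ hμ hK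
  refine measure_eq_zero_of_cylinder_bound μ (measurableSet_trappedSet H K) ?_ hε ?_
  · intro ω hω n
    obtain ⟨η, hη, he⟩ := hω n
    exact he ▸ hη n
  · intro ω hω n hn
    refine hbound _ (fun h => hn ?_) (hω n)
    rw [← wlen_trunc ω n, h]
    simp [wlen]

end FreeBoundary

/-- **Complete dissipativity for finitely generated subgroups of infinite index.** -/
theorem fg_infinite_index_completely_dissipative (m : ℕ) (hm : 2 ≤ m)
    (μ : Measure (Boundary m)) [IsProbabilityMeasure μ]
    (hμ : ∀ g : FreeGroup (Fin m), g ≠ 1 →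
      μ (cylinder g) = ((2 * m * (2 * m - 1) ^ (wlen g - 1) : ℕ) : ℝ≥0∞)⁻¹)
    (H : Subgroup (FreeGroup (Fin m))) (hfg : H.FG) (hinf : H.index = 0) :
    ∃ W : Set (Boundary m), MeasurableSet W ∧
      (∀ h h' : H, h ≠ h' →
        μ (bact (h : FreeGroup (Fin m)) '' W ∩ bact (h' : FreeGroup (Fin m)) '' W) = 0) ∧
      μ (Set.univ \ ⋃ h : H, bact (h : FreeGroup (Fin m)) '' W) = 0 := by
  have hinf' : Infinite (FreeGroup (Fin m) ⧸ H) := Subgroup.index_eq_zero_iff_infinite.1 hinf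
  obtain ⟨K, hK, hKH⟩ := FreeBoundary.exists_finite_core hfg
  obtain ⟨V, hVm, hVw, hVs⟩ := FreeBoundary.exists_seq_isWandering H
  obtain ⟨W, hWm, hWd, hWs⟩ := FreeBoundary.exists_fundamental_set H V hVm hVw
  refine ⟨W, hWm, fun h h' hne => ?_, ?_⟩
  · rw [(hWd h h' hne).inter_eq, measure_empty]
  · refine measure_mono_null ?_ (FreeBoundary.measure_trappedSet_eq_zero hm μ hμ hK)
    rw [← Set.compl_eq_univ_sdiff]
    exact (Set.compl_subset_compl.2 (hVs.trans hWs)).trans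
      (FreeBoundary.compl_iUnion_separatedSet_subset hKH)
end
end

section
/- Let F be a free group of finite rank m ≥ 2 and let H ≤ F be a finitely generated subgroup which contains a nontrivial normal subgroup of F, i.e. there exists N ⊴ F with N ≠ {1} and N ⊆ H. Then H has finite index in F. -/
theorem List.prefix_or_prefix_of_prefix_append {α : Type*} {p a c : List α} (h : p <+: a ++ c) :
    p <+: a ∨ ∃ r, p = a ++ r ∧ r <+: c := by
  obtain ⟨q, hq⟩ := h
  rcases List.append_eq_append_iff.1 hq with ⟨r, rfl, -⟩ | ⟨r, rfl, rfl⟩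
  · exact Or.inl (List.prefix_append _ _)
  · exact Or.inr ⟨r, rfl, List.prefix_append _ _⟩

open FreeGroup in
/-- A property of the elements represented by the prefixes of a word is inherited by every
reduction of that word. -/
theorem FreeGroup.Red.forall_prefix {α : Type*} {Q : FreeGroup α → Prop}
    {L₁ L₂ : List (α × Bool)} (h : Red L₁ L₂) (hQ : ∀ p, p <+: L₁ → Q (mk p)) :
    ∀ p, p <+: L₂ → Q (mk p) := by
  induction h with
  | refl => exact hQ
  | tail _ hstep ih =>
    obtain @⟨a, c, x, b⟩ := hstep
    intro p hp
    rcases List.prefix_or_prefix_of_prefix_append hp with hp | ⟨r, rfl, hr⟩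
    · exact ih p (hp.trans (List.prefix_append _ _))
    · have key : mk (a ++ (x, b) :: (x, !b) :: r) = mk (a ++ r) := Quot.sound Red.Step.not
      rw [← key]
      refine ih _ ?_
      simpa using hr

open FreeGroup in
/-- Each element of a finitely generated subgroup `H` of a free group is represented by a reduced
word all of whose prefixes lie in finitely many right cosets of `H`. -/
theorem FreeGroup.exists_finite_prefix_cosets {α : Type*} [DecidableEq α]
    {H : Subgroup (FreeGroup α)} (hfg : H.FG) :
    ∃ T : Set (FreeGroup α), T.Finite ∧
      ∀ h ∈ H, ∀ p, p <+: h.toWord → ∃ t ∈ T, mk p * t⁻¹ ∈ H := by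
  obtain ⟨S, rfl⟩ := hfg
  refine ⟨insert 1 (⋃ s ∈ S, Set.image mk {p | p <+: s.toWord}), ?_, ?_⟩
  · refine Set.Finite.insert _ (S.finite_toSet.biUnion fun s _ => Set.Finite.image _ ?_)
    refine (s.toWord.inits.toFinset.finite_toSet).subset fun p hp => ?_
    simpa using hp
  set T : Set (FreeGroup α) := insert 1 (⋃ s ∈ S, Set.image mk {p | p <+: s.toWord})
  set H := Subgroup.closure (S : Set (FreeGroup α))
  have hmul : ∀ h ∈ H, ∀ g, (∃ t ∈ T, g * t⁻¹ ∈ H) → ∃ t ∈ T, h * g * t⁻¹ ∈ H := by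
    rintro h hh g ⟨t, ht, hg⟩
    exact ⟨t, ht, by simpa [mul_assoc] using H.mul_mem hh hg⟩
  have hword : ∀ h ∈ H, ∃ w, mk w = h ∧ ∀ p, p <+: w → ∃ t ∈ T, mk p * t⁻¹ ∈ H := by
    intro h hh
    induction hh using Subgroup.closure_induction with
    | mem s hs =>
      refine ⟨s.toWord, mk_toWord, fun p hp => ⟨mk p, Or.inr ?_,
        (mul_inv_cancel (mk p)).symm ▸ H.one_mem⟩⟩
      exact Set.mem_biUnion hs ⟨p, hp, rfl⟩
    | one =>
      refine ⟨[], rfl, fun p hp => ⟨1, Or.inl rfl, ?_⟩⟩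
      obtain rfl := List.prefix_nil.1 hp
      simp [← one_eq_mk]
    | mul x y hx hy ihx ihy =>
      obtain ⟨u, rfl, hu⟩ := ihx
      obtain ⟨v, rfl, hv⟩ := ihy
      refine ⟨u ++ v, mul_mk.symm, fun p hp => ?_⟩
      rcases List.prefix_or_prefix_of_prefix_append hp with hp | ⟨r, rfl, hr⟩
      · exact hu p hp
      · rw [← mul_mk]
        exact hmul _ hx _ (hv r hr)
    | inv x hx ih =>
      obtain ⟨u, rfl, hu⟩ := ih
      refine ⟨invRev u, inv_mk.symm, ?_⟩
      rintro p ⟨q, hq⟩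
      have huq : u = invRev q ++ invRev p := by
        rw [← invRev_append, hq, invRev_invRev]
      have hp : mk p = (mk u)⁻¹ * mk (invRev q) := by
        rw [huq, ← mul_mk, ← inv_mk, ← inv_mk]
        group
      rw [hp]
      exact hmul _ (H.inv_mem hx) _ (hu _ ⟨invRev p, huq.symm⟩)
  intro h hh
  obtain ⟨w, rfl, hw⟩ := hword h hh
  rw [toWord_mk]
  exact reduce.red.forall_prefix (Q := fun g => ∃ t ∈ T, g * t⁻¹ ∈ H) hw

open FreeGroup in
theorem FreeGroup.IsReduced.invRev {α : Type*} {L : List (α × Bool)} (h : IsReduced L) :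
    IsReduced (FreeGroup.invRev L) := by
  classical
  rw [isReduced_iff_reduce_eq] at h ⊢
  rw [reduce_invRev, h]

open FreeGroup in
/-- If there are at least four letters, every reduced word can be prolonged by one letter so that
conjugating a given nontrivial reduced word by the result involves no cancellation. -/
theorem FreeGroup.exists_isReduced_conj {α : Type*} [Fintype α] (hα : 2 ≤ Fintype.card α)
    {u w : List (α × Bool)} (hu : IsReduced u) (hw : IsReduced w) (hw0 : w ≠ []) :
    ∃ x, IsReduced (u ++ [x] ++ w ++ invRev (u ++ [x])) := by
  classical
  obtain ⟨a, ha⟩ : ∃ a, ∀ y ∈ u.getLast?, y = a := by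
    cases u.getLast? with
    | none => exact ⟨w.head hw0, by simp⟩
    | some y => exact ⟨y, by simp⟩
  set b := w.head hw0
  set c := w.getLast hw0
  obtain ⟨x, hx⟩ : ∃ x, x ∉ ({(a.1, !a.2), (b.1, !b.2), c} : Finset (α × Bool)) := by
    by_contra! hall
    have h1 := Finset.card_le_three (a := (a.1, !a.2)) (b := (b.1, !b.2)) (c := c)
    rw [Finset.eq_univ_iff_forall.2 hall, Finset.card_univ, Fintype.card_prod,
      Fintype.card_bool] at h1
    omega
  simp only [Finset.mem_insert, Finset.mem_singleton, not_or, Prod.ext_iff] at hx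
  obtain ⟨hxa, hxb, hxc⟩ := hx
  have hux : IsReduced (u ++ [x]) := by
    refine List.isChain_append.2 ⟨hu, IsReduced.singleton, ?_⟩
    intro y hy z hz
    obtain rfl := ha y hy
    simp only [List.head?_cons, Option.mem_def, Option.some.injEq] at hz
    grind
  refine ⟨x, List.isChain_append.2 ⟨List.isChain_append.2 ⟨hux, hw, ?_⟩, hux.invRev, ?_⟩⟩
  · intro y hy z hz
    rw [List.head?_eq_some_head hw0] at hz
    simp at hy hz
    grind
  · intro y hy z hz h
    rw [List.getLast?_append_of_ne_nil _ hw0, List.getLast?_eq_some_getLast hw0] at hy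
    simp only [Option.mem_def, Option.some.injEq] at hy
    simp [invRev] at hz
    subst hy hz
    exact Bool.eq_not_of_ne fun h2 => hxc ⟨h.symm, h2.symm⟩

/-- **Karrass–Solitar theorem.** A finitely generated subgroup of a free group of finite
rank `m ≥ 2` which contains a nontrivial normal subgroup of the free group has finite
index. -/
theorem karrass_solitar (m : ℕ) (hm : 2 ≤ m)
    (H : Subgroup (FreeGroup (Fin m))) (hfg : H.FG)
    (N : Subgroup (FreeGroup (Fin m))) (hN : N.Normal) (hNbot : N ≠ ⊥) (hNH : N ≤ H) :
    H.FiniteIndex := by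
  obtain ⟨T, hTfin, hT⟩ := FreeGroup.exists_finite_prefix_cosets hfg
  obtain ⟨n, hn, hn1⟩ := N.bot_or_exists_ne_one.resolve_left hNbot
  have hcoset : ∀ g : FreeGroup (Fin m), ∃ t ∈ T, g * t⁻¹ ∈ H := by
    intro g
    obtain ⟨x, hx⟩ := FreeGroup.exists_isReduced_conj (by simpa using hm)
      (FreeGroup.isReduced_toWord (x := g)) (FreeGroup.isReduced_toWord (x := n))
      (by simpa using hn1)
    set v := g.toWord ++ [x] with hv
    have hmem : FreeGroup.mk (v ++ FreeGroup.toWord n ++ FreeGroup.invRev v) ∈ H := by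
      rw [← FreeGroup.mul_mk, ← FreeGroup.mul_mk, ← FreeGroup.inv_mk, FreeGroup.mk_toWord]
      exact hNH (hN.conj_mem _ hn _)
    have key := hT _ hmem g.toWord (by
      rw [FreeGroup.toWord_mk, hx.reduce_eq, hv]
      simp only [List.append_assoc, List.prefix_append])
    rwa [FreeGroup.mk_toWord] at key
  have : Finite (FreeGroup (Fin m) ⧸ H) := by
    refine Set.finite_univ_iff.1 ((hTfin.image fun t =>
      (QuotientGroup.mk t⁻¹ : FreeGroup (Fin m) ⧸ H)).subset fun q _ => ?_)
    obtain ⟨g, rfl⟩ := QuotientGroup.mk_surjective q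
    obtain ⟨t, ht, hgt⟩ := hcoset g⁻¹
    refine ⟨t, ht, QuotientGroup.eq.2 ?_⟩
    simpa using H.inv_mem hgt
  exact H.finiteIndex_of_finite_quotient
end

section
/- Let H ≤ F be a subgroup. Put a₀ = 1 and aₙ = |S_X^n| / (2m(2m−1)^{n−1}) for n ≥ 1, where S_X^n = { x ∈ H\F : |x|_X = n }. Then the sequence (aₙ)_{n≥0} is nonincreasing: a_{n+1} ≤ aₙ for all n ≥ 0; in particular it converges. -/
open MeasureTheory Filter Topology
open scoped ENNReal symmDiff

noncomputable section

/-- The Schreier-graph distance from the basepoint: for a right coset `Hg`,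
`normX H x = min { |hg| : h ∈ H }`. -/
def normX {m : ℕ} (H : Subgroup (FreeGroup (Fin m)))
    (x : Quotient (QuotientGroup.rightRel H)) : ℕ :=
  sInf {n | ∃ g : FreeGroup (Fin m), Quotient.mk (QuotientGroup.rightRel H) g = x ∧ wlen g = n}

theorem wlen_mul_mk_singleton_le {m : ℕ} (g : FreeGroup (Fin m)) (s : Letter m) :
    wlen (g * FreeGroup.mk [s]) ≤ wlen g + 1 :=
  (FreeGroup.norm_mul_le g (FreeGroup.mk [s])).trans
    (Nat.add_le_add_left (FreeGroup.norm_mk_le (L₁ := [s])) _)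

theorem exists_eq_mul_mk_singleton {m n : ℕ} {g : FreeGroup (Fin m)} (hg : wlen g = n + 1) :
    ∃ (h : FreeGroup (Fin m)) (s : Letter m), wlen h ≤ n ∧ g = h * FreeGroup.mk [s] := by
  have hne : g.toWord ≠ [] := by
    intro h
    simp [wlen, h] at hg
  refine ⟨FreeGroup.mk g.toWord.dropLast, g.toWord.getLast hne, ?_, ?_⟩
  · refine (FreeGroup.norm_mk_le (L₁ := g.toWord.dropLast)).trans ?_
    rw [List.length_dropLast]
    simp only [wlen] at hg
    omega
  · rw [FreeGroup.mul_mk, List.dropLast_append_getLast hne, FreeGroup.mk_toWord]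

theorem mk_singleton_mul_mk_linv {m : ℕ} (s : Letter m) :
    FreeGroup.mk [s] * FreeGroup.mk [linv s] = 1 := by
  have h : FreeGroup.mk [linv s] = (FreeGroup.mk [s])⁻¹ := by
    simp [FreeGroup.inv_mk, FreeGroup.invRev, linv]
  rw [h, mul_inv_cancel]

theorem normX_mk_le {m : ℕ} (H : Subgroup (FreeGroup (Fin m))) (g : FreeGroup (Fin m)) :
    normX H (Quotient.mk _ g) ≤ wlen g :=
  Nat.sInf_le ⟨g, rfl, rfl⟩

theorem exists_wlen_eq_normX {m : ℕ} (H : Subgroup (FreeGroup (Fin m)))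
    (x : Quotient (QuotientGroup.rightRel H)) :
    ∃ g : FreeGroup (Fin m), Quotient.mk (QuotientGroup.rightRel H) g = x ∧
      wlen g = normX H x := by
  obtain ⟨g, hg⟩ := Quotient.exists_rep x
  exact Nat.sInf_mem (s := {n | ∃ g : FreeGroup (Fin m),
    Quotient.mk (QuotientGroup.rightRel H) g = x ∧ wlen g = n}) ⟨wlen g, g, hg, rfl⟩

theorem mk_mul_right_eq {m : ℕ} {H : Subgroup (FreeGroup (Fin m))} {g h : FreeGroup (Fin m)}
    (hgh : Quotient.mk (QuotientGroup.rightRel H) g = Quotient.mk _ h) (k : FreeGroup (Fin m)) :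
    Quotient.mk (QuotientGroup.rightRel H) (g * k) = Quotient.mk _ (h * k) := by
  have h1 := QuotientGroup.rightRel_apply.mp (Quotient.exact hgh)
  refine Quotient.sound (QuotientGroup.rightRel_apply.mpr ?_)
  simpa [mul_assoc] using h1

/-- The sphere of radius `n` in the Schreier graph of `H`. -/
def schreierSphere {m : ℕ} (H : Subgroup (FreeGroup (Fin m))) (n : ℕ) :
    Set (Quotient (QuotientGroup.rightRel H)) :=
  {x | normX H x = n}

/-- Every point of the sphere of radius `n + 1` is obtained from a point `x` of the sphere of
radius `n` by appending a letter to a prescribed shortest representative of `x`. -/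
theorem exists_mem_schreierSphere_of_succ {m n : ℕ} {H : Subgroup (FreeGroup (Fin m))}
    {r : Quotient (QuotientGroup.rightRel H) → FreeGroup (Fin m)}
    (hr : ∀ x, Quotient.mk (QuotientGroup.rightRel H) (r x) = x)
    (hrn : ∀ x, wlen (r x) = normX H x)
    {y : Quotient (QuotientGroup.rightRel H)} (hy : y ∈ schreierSphere H (n + 1)) :
    ∃ x ∈ schreierSphere H n, ∃ s : Letter m,
      Quotient.mk (QuotientGroup.rightRel H) (r x * FreeGroup.mk [s]) = y := by
  have hy' : normX H y = n + 1 := hy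
  obtain ⟨g, s, hgn, hg⟩ := exists_eq_mul_mk_singleton ((hrn y).trans hy')
  have hys : Quotient.mk (QuotientGroup.rightRel H)
      (r (Quotient.mk _ g) * FreeGroup.mk [s]) = y := by
    rw [mk_mul_right_eq (hr (Quotient.mk _ g)), ← hg, hr]
  refine ⟨Quotient.mk _ g, le_antisymm ((normX_mk_le H g).trans hgn) ?_, s, hys⟩
  have h1 := (normX_mk_le H _).trans
    (wlen_mul_mk_singleton_le (r (Quotient.mk (QuotientGroup.rightRel H) g)) s)
  rw [hys, hy', hrn] at h1
  omega

/-- If only `k` letters at each point of a finite sphere can lead to the next sphere, then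
that sphere is finite with at most `k` times as many points. -/
theorem schreierSphere_succ_finite_and_ncard_le {m n k : ℕ} {H : Subgroup (FreeGroup (Fin m))}
    {r : Quotient (QuotientGroup.rightRel H) → FreeGroup (Fin m)}
    (hr : ∀ x, Quotient.mk (QuotientGroup.rightRel H) (r x) = x)
    (hrn : ∀ x, wlen (r x) = normX H x) (hfin : (schreierSphere H n).Finite)
    (E : Quotient (QuotientGroup.rightRel H) → Finset (Letter m))
    (hE : ∀ x, (E x).card ≤ k)
    (hmem : ∀ x ∈ schreierSphere H n, ∀ s : Letter m,
      Quotient.mk (QuotientGroup.rightRel H) (r x * FreeGroup.mk [s]) ∈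
        schreierSphere H (n + 1) → s ∈ E x) :
    (schreierSphere H (n + 1)).Finite ∧
      (schreierSphere H (n + 1)).ncard ≤ (schreierSphere H n).ncard * k := by
  classical
  let U := hfin.toFinset.biUnion fun x => (E x).image fun s =>
    Quotient.mk (QuotientGroup.rightRel H) (r x * FreeGroup.mk [s])
  have hsub : schreierSphere H (n + 1) ⊆ (U : Set (Quotient (QuotientGroup.rightRel H))) := by
    intro y hy
    obtain ⟨x, hx, s, rfl⟩ := exists_mem_schreierSphere_of_succ hr hrn hy
    exact Finset.mem_coe.mpr (Finset.mem_biUnion.mpr ⟨x, hfin.mem_toFinset.mpr hx,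
      Finset.mem_image_of_mem _ (hmem x hx s hy)⟩)
  refine ⟨U.finite_toSet.subset hsub, (Set.ncard_le_ncard hsub U.finite_toSet).trans ?_⟩
  rw [Set.ncard_coe_finset, Set.ncard_eq_toFinset_card _ hfin]
  exact Finset.card_biUnion_le_card_mul _ _ _ fun x _ => Finset.card_image_le.trans (hE x)

theorem schreierSphere_zero_subset {m : ℕ} (H : Subgroup (FreeGroup (Fin m))) :
    schreierSphere H 0 ⊆ {Quotient.mk _ 1} := by
  intro x hx
  obtain ⟨g, rfl, hg⟩ := exists_wlen_eq_normX H x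
  have h0 : FreeGroup.norm g = 0 := hg.trans hx
  rw [FreeGroup.norm_eq_zero.mp h0]
  rfl

theorem card_letter (m : ℕ) : (Finset.univ : Finset (Letter m)).card = 2 * m := by
  simp [mul_comm]

theorem schreierSphere_finite {m : ℕ} (H : Subgroup (FreeGroup (Fin m))) (n : ℕ) :
    (schreierSphere H n).Finite := by
  choose r hr hrn using exists_wlen_eq_normX H
  induction n with
  | zero => exact (Set.finite_singleton _).subset (schreierSphere_zero_subset H)
  | succ n ih =>
    exact (schreierSphere_succ_finite_and_ncard_le hr hrn ih (fun _ => Finset.univ)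
      (fun _ => le_rfl) fun _ _ s _ => Finset.mem_univ s).1

theorem ncard_schreierSphere_one_le {m : ℕ} (H : Subgroup (FreeGroup (Fin m))) :
    (schreierSphere H 1).ncard ≤ 2 * m := by
  choose r hr hrn using exists_wlen_eq_normX H
  have h1 := (schreierSphere_succ_finite_and_ncard_le hr hrn (schreierSphere_finite H 0)
    (fun _ => Finset.univ) (fun _ => (card_letter m).le) fun _ _ s _ => Finset.mem_univ s).2
  have h0 := Set.ncard_le_ncard (schreierSphere_zero_subset H) (Set.finite_singleton _)
  rw [Set.ncard_singleton] at h0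
  exact h1.trans (by simpa using Nat.mul_le_mul_right (2 * m) h0)

theorem ncard_schreierSphere_add_two_le {m : ℕ} (hm : 0 < m) (H : Subgroup (FreeGroup (Fin m)))
    (n : ℕ) :
    (schreierSphere H (n + 2)).ncard ≤ (schreierSphere H (n + 1)).ncard * (2 * m - 1) := by
  choose r hr hrn using exists_wlen_eq_normX H
  have hback : ∀ x, ∃ b : Letter m, x ∈ schreierSphere H (n + 1) →
      wlen (r x * FreeGroup.mk [b]) ≤ n := by
    intro x
    by_cases hx : x ∈ schreierSphere H (n + 1)
    · obtain ⟨h, s, hh, hs⟩ := exists_eq_mul_mk_singleton ((hrn x).trans hx)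
      refine ⟨linv s, fun _ => ?_⟩
      rwa [hs, mul_assoc, mk_singleton_mul_mk_linv, mul_one]
    · exact ⟨(⟨0, hm⟩, true), fun h => absurd h hx⟩
  choose b hb using hback
  refine (schreierSphere_succ_finite_and_ncard_le hr hrn (schreierSphere_finite H (n + 1))
    (fun x => Finset.univ.erase (b x)) (fun x => ?_) fun x hx s hs => ?_).2
  · rw [Finset.card_erase_of_mem (Finset.mem_univ _), card_letter]
  · refine Finset.mem_erase.mpr ⟨?_, Finset.mem_univ s⟩
    rintro rfl
    have h1 : normX H _ = n + 1 + 1 := hs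
    have h2 := (normX_mk_le H _).trans (hb x hx)
    omega

/-- **Monotonicity of sphere ratios in the Schreier graph.** The normalized sphere sizes
`aₙ = |S_X^n| / (2m(2m-1)^{n-1})`, `a₀ = 1`, form a nonincreasing (hence convergent)
sequence. -/
theorem schreier_sphere_ratio_monotone (m : ℕ) (hm : 2 ≤ m)
    (H : Subgroup (FreeGroup (Fin m)))
    (a : ℕ → ℝ) (ha0 : a 0 = 1)
    (ha : ∀ n : ℕ, 1 ≤ n → a n =
      (Nat.card {x : Quotient (QuotientGroup.rightRel H) // normX H x = n} : ℝ) /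
        ((2 * m * (2 * m - 1) ^ (n - 1) : ℕ) : ℝ)) :
    (∀ n : ℕ, a (n + 1) ≤ a n) ∧ ∃ L : ℝ, Tendsto a atTop (𝓝 L) := by
  have hcard : ∀ n, Nat.card {x : Quotient (QuotientGroup.rightRel H) // normX H x = n} =
      (schreierSphere H n).ncard := fun n => rfl
  simp only [hcard] at ha
  have hmono : ∀ n : ℕ, a (n + 1) ≤ a n := by
    rintro (_ | n)
    · rw [ha0, ha 1 le_rfl]
      refine div_le_one_of_le₀ ?_ (Nat.cast_nonneg _)
      exact_mod_cast by simpa using ncard_schreierSphere_one_le H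
    · rw [ha (n + 1) (by omega), ha (n + 1 + 1) (by omega)]
      have hk : 0 < 2 * m - 1 := by omega
      have hm0 : 0 < m := by omega
      simp only [Nat.add_sub_cancel]
      rw [div_le_div_iff₀ (by exact_mod_cast by positivity) (by exact_mod_cast by positivity)]
      norm_cast
      calc _ ≤ (schreierSphere H (n + 1)).ncard * (2 * m - 1) * (2 * m * (2 * m - 1) ^ n) :=
            Nat.mul_le_mul_right _ (ncard_schreierSphere_add_two_le hm0 H n)
        _ = _ := by ring
  have hnonneg : ∀ n, 0 ≤ a n := by
    rintro (_ | n)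
    · rw [ha0]
      exact zero_le_one
    · rw [ha (n + 1) (by omega)]
      positivity
  refine ⟨hmono, _, tendsto_atTop_ciInf (antitone_nat_of_succ_le hmono) ⟨0, ?_⟩⟩
  rintro _ ⟨n, rfl⟩
  exact hnonneg n
end
end
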